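/- Let n ≥ 9 be an integer and let p, q be integers with 1 ≤ p, q ≤ n−3. Then a(n) ≥ s(n;p,q), where s(n;p,q) = β(n) − 4n² + 20n − 18 + p(n−p−2)² + p(n−p−1)² − U(p+2) − p + q(n−q−2)² + q(n−q−1)² − U(q+1) − q. -/

import Mathlib

/-- The grid `A_n = {(x,y) ∈ ℤ² : 1 ≤ x, y ≤ n}`. -/
def gridSet (n : ℕ) : Set (ℤ × ℤ) :=
  {p | 1 ≤ p.1 ∧ p.1 ≤ (n : ℤ) ∧ 1 ≤ p.2 ∧ p.2 ≤ (n : ℤ)}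

/-- The embedding of an integer lattice point into the real plane. -/
def toR2 (p : ℤ × ℤ) : ℝ × ℝ := ((p.1 : ℝ), (p.2 : ℝ))

/-- Squared Euclidean distance between two lattice points, as a natural number. -/
def sqLen (p q : ℤ × ℤ) : ℕ := (q.1 - p.1).natAbs ^ 2 + (q.2 - p.2).natAbs ^ 2

/-- `f : ZMod (n²) → ℤ × ℤ` is a simple closed grid polygon on `A_n`:
it is a bijection onto `A_n`, and any two distinct (closed) edges of the closed
polygonal curve `f 0, f 1, …, f (n²-1), f 0` meet only in common endpoints. -/
structure IsSimpleClosedGridPolygon (n : ℕ) (f : ZMod (n ^ 2) → ℤ × ℤ) : Prop where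
  inj : Function.Injective f
  range_eq : Set.range f = gridSet n
  simple : ∀ i j : ZMod (n ^ 2), i ≠ j →
    segment ℝ (toR2 (f i)) (toR2 (f (i + 1))) ∩
        segment ℝ (toR2 (f j)) (toR2 (f (j + 1))) ⊆
      ({toR2 (f i), toR2 (f (i + 1))} : Set (ℝ × ℝ)) ∩
        ({toR2 (f j), toR2 (f (j + 1))} : Set (ℝ × ℝ))

/-- The weight `s(f)`: sum of the squared Euclidean side lengths. -/
def polyWeight (n : ℕ) (f : ZMod (n ^ 2) → ℤ × ℤ) : ℕ :=
  ∑ i ∈ Finset.range (n ^ 2), sqLen (f (i : ZMod (n ^ 2))) (f ((i : ZMod (n ^ 2)) + 1))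

/-- `a(n)`: the maximal weight of a simple closed grid polygon on `A_n`. -/
noncomputable def polyA (n : ℕ) : ℕ :=
  sSup {w : ℕ | ∃ f, IsSimpleClosedGridPolygon n f ∧ polyWeight n f = w}

/-- A grid polygon is proper if no three consecutive vertices are collinear. -/
def IsProper (n : ℕ) (f : ZMod (n ^ 2) → ℤ × ℤ) : Prop :=
  ∀ i : ZMod (n ^ 2),
    ¬ Collinear ℝ ({toR2 (f i), toR2 (f (i + 1)), toR2 (f (i + 2))} : Set (ℝ × ℝ))

/-- `a₀(n)`: the maximal weight of a proper simple closed grid polygon on `A_n`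
(the supremum in `ℕ`, equal to `0` if no proper polygon exists). -/
noncomputable def polyA0 (n : ℕ) : ℕ :=
  sSup {w : ℕ | ∃ f, IsSimpleClosedGridPolygon n f ∧ IsProper n f ∧ polyWeight n f = w}


/-- The residue-dependent correction term `c(n)` of the main theorem. -/
def cCorr (n : ℕ) : ℚ :=
  if n % 9 = 0 then -(4/3) * n ^ 2 + 6 * n - 2
  else if n % 9 = 1 then -(292/243) * n ^ 2 + (922/243) * n - 1642/729
  else if n % 9 = 2 then -(308/243) * n ^ 2 + (946/243) * n - 1724/729
  else if n % 9 = 3 then -(4/3) * n ^ 2 + (158/27) * n - 64/27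
  else if n % 9 = 4 then -(292/243) * n ^ 2 + (886/243) * n - 1804/729
  else if n % 9 = 5 then -(308/243) * n ^ 2 + (874/243) * n - 1400/729
  else if n % 9 = 6 then -(4/3) * n ^ 2 + (158/27) * n - 44/27
  else if n % 9 = 7 then -(292/243) * n ^ 2 + (886/243) * n - 1264/729
  else -(308/243) * n ^ 2 + (946/243) * n - 1292/729

/-- The sequence `α(n)` from the main theorem. -/
def alphaSeq (n : ℕ) : ℚ := (8/27) * n ^ 4 - (464/729) * n ^ 3 + cCorr n

/-- The residue-dependent correction term `d(n)`. -/
def dCorr (n : ℕ) : ℚ :=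
  if n % 3 = 0 then 0
  else if n % 3 = 1 then -(8 * n + 4) / 27
  else -(16 * n - 16) / 27

/-- The first-approximation sequence `β(n)`. -/
def betaSeq (n : ℕ) : ℚ :=
  (8/27) * n ^ 4 - (32/27) * n ^ 3 + (16/3) * n ^ 2 - 18 * n + 20 + dCorr n

/-- The gain function `F(j,k)`. -/
def Fgain (j k : ℤ) : ℤ :=
  4 * j ^ 3 - (8 * k + 2) * j ^ 2 + (4 * k ^ 2 + 4 * k) * j - 2 * k ^ 2 - 2 * k + 3

/-- The maximal gain `U(k)`, defined piecewise by `k` modulo 3: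
`U(3s) = 16s³ − 8s² − 6s + 3`, `U(3s+1) = 16s³ + 8s² − 6s + 1`,
`U(3s+2) = 16s³ + 24s² + 6s + 1`. -/
def Ugain (k : ℤ) : ℤ :=
  if k % 3 = 0 then 16 * (k / 3) ^ 3 - 8 * (k / 3) ^ 2 - 6 * (k / 3) + 3
  else if k % 3 = 1 then 16 * (k / 3) ^ 3 + 8 * (k / 3) ^ 2 - 6 * (k / 3) + 1
  else 16 * (k / 3) ^ 3 + 24 * (k / 3) ^ 2 + 6 * (k / 3) + 1

/-- The weight `s(n;p,q)` of the fjord construction with `p` fjords at the bottom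
and `q` fjords to the right. -/
def sFjord (n : ℕ) (p q : ℤ) : ℚ :=
  betaSeq n - 4 * n ^ 2 + 20 * n - 18
    + (p : ℚ) * ((n : ℚ) - p - 2) ^ 2 + (p : ℚ) * ((n : ℚ) - p - 1) ^ 2
      - (Ugain (p + 2) : ℚ) - (p : ℚ)
    + (q : ℚ) * ((n : ℚ) - q - 2) ^ 2 + (q : ℚ) * ((n : ℚ) - q - 1) ^ 2
      - (Ugain (q + 1) : ℚ) - (q : ℚ)


/-- The consecutive pairs of a list of lattice points. -/
def edges : List (ℤ × ℤ) → List ((ℤ × ℤ) × (ℤ × ℤ))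
  | [] => []
  | [_] => []
  | a :: b :: l => (a, b) :: edges (b :: l)

/-- Two edges, as closed segments, meet only in common endpoints. -/
def NonCrossing (e e' : (ℤ × ℤ) × (ℤ × ℤ)) : Prop :=
  segment ℝ (toR2 e.1) (toR2 e.2) ∩ segment ℝ (toR2 e'.1) (toR2 e'.2) ⊆
    ({toR2 e.1, toR2 e.2} : Set (ℝ × ℝ)) ∩ ({toR2 e'.1, toR2 e'.2} : Set (ℝ × ℝ))

/-- An edge without lattice points in its interior. -/
def Primitive (e : (ℤ × ℤ) × (ℤ × ℤ)) : Prop :=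
  IsCoprime (e.2.1 - e.1.1) (e.2.2 - e.1.2)

/-- A simple open grid polygon with primitive edges. -/
structure IsSimplePath (l : List (ℤ × ℤ)) : Prop where
  nodup : l.Nodup
  nonCrossing : (edges l).Pairwise NonCrossing
  primitive : ∀ e ∈ edges l, Primitive e

/-- The sum of the squared edge lengths of an open polygon. -/
def weight (l : List (ℤ × ℤ)) : ℕ := ((edges l).map fun e => sqLen e.1 e.2).sum

theorem NonCrossing.symm {e e' : (ℤ × ℤ) × (ℤ × ℤ)} (h : NonCrossing e e') :
    NonCrossing e' e := by
  unfold NonCrossing at *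
  rw [Set.inter_comm, Set.inter_comm ({toR2 e'.1, _} : Set _)]
  exact h

theorem NonCrossing.swap {e e' : (ℤ × ℤ) × (ℤ × ℤ)} (h : NonCrossing e e') :
    NonCrossing e.swap e'.swap := by
  unfold NonCrossing at *
  simp only [Prod.fst_swap, Prod.snd_swap]
  rw [segment_symm, segment_symm ℝ (toR2 e'.2), Set.pair_comm, Set.pair_comm (toR2 e'.2)]
  exact h

theorem Primitive.swap {e : (ℤ × ℤ) × (ℤ × ℤ)} (h : Primitive e) : Primitive e.swap := by
  unfold Primitive at *
  simp only [Prod.fst_swap, Prod.snd_swap]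
  rw [← neg_sub e.2.1, ← neg_sub e.2.2]
  exact h.neg_neg

theorem toR2_injective : Function.Injective toR2 := by
  rintro ⟨a, b⟩ ⟨c, d⟩ h
  simpa [toR2] using h

theorem Primitive.eq_or_eq {e : (ℤ × ℤ) × (ℤ × ℤ)} (h : Primitive e) {z : ℤ × ℤ}
    (hz : toR2 z ∈ segment ℝ (toR2 e.1) (toR2 e.2)) : z = e.1 ∨ z = e.2 := by
  obtain ⟨k, l, hkl⟩ := h
  rw [segment_eq_image] at hz
  obtain ⟨s, ⟨hs0, hs1⟩, hs⟩ := hz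
  have h1 : (1 - s) * (e.1.1 : ℝ) + s * e.2.1 = z.1 := by
    simpa [toR2] using congrArg Prod.fst hs
  have h2 : (1 - s) * (e.1.2 : ℝ) + s * e.2.2 = z.2 := by
    simpa [toR2] using congrArg Prod.snd hs
  have hkl' : (k : ℝ) * (e.2.1 - e.1.1) + l * (e.2.2 - e.1.2) = 1 := by exact_mod_cast hkl
  have h3 : s = ((k * (z.1 - e.1.1) + l * (z.2 - e.1.2) : ℤ) : ℝ) := by
    push_cast
    linear_combination (-s) * hkl' + k * h1 + l * h2
  set r : ℤ := k * (z.1 - e.1.1) + l * (z.2 - e.1.2)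
  rw [h3] at hs0 hs1
  have hr0 : 0 ≤ r := by exact_mod_cast hs0
  have hr1 : r ≤ 1 := by exact_mod_cast hs1
  have hr : r = 0 ∨ r = 1 := by omega
  rcases hr with hr | hr
  · left
    apply toR2_injective
    rw [← hs, h3, hr]
    simp
  · right
    apply toR2_injective
    rw [← hs, h3, hr]
    simp

theorem eq_endpoint_of_le {e : (ℤ × ℤ) × (ℤ × ℤ)} {k l v : ℤ}
    (h1 : k * e.1.1 + l * e.1.2 ≤ v) (h2 : k * e.2.1 + l * e.2.2 ≤ v)
    (hlt : k * e.1.1 + l * e.1.2 < v ∨ k * e.2.1 + l * e.2.2 < v) {z : ℝ × ℝ}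
    (hz : z ∈ segment ℝ (toR2 e.1) (toR2 e.2)) (hv : (v : ℝ) ≤ k * z.1 + l * z.2) :
    z = toR2 e.1 ∨ z = toR2 e.2 := by
  rw [segment_eq_image] at hz
  obtain ⟨s, ⟨hs0, hs1⟩, rfl⟩ := hz
  simp only [toR2, Prod.smul_mk, Prod.mk_add_mk, smul_eq_mul] at hv
  have h1' : (k : ℝ) * e.1.1 + l * e.1.2 ≤ v := by exact_mod_cast h1
  have h2' : (k : ℝ) * e.2.1 + l * e.2.2 ≤ v := by exact_mod_cast h2
  rcases hlt with hlt | hlt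
  · right
    have hlt' : (k : ℝ) * e.1.1 + l * e.1.2 < v := by exact_mod_cast hlt
    have : s = 1 := by nlinarith
    simp [this]
  · left
    have hlt' : (k : ℝ) * e.2.1 + l * e.2.2 < v := by exact_mod_cast hlt
    have : s = 0 := by nlinarith
    simp [this]

theorem le_of_mem_segment {e : (ℤ × ℤ) × (ℤ × ℤ)} {k l v : ℤ}
    (h1 : v ≤ k * e.1.1 + l * e.1.2) (h2 : v ≤ k * e.2.1 + l * e.2.2) {z : ℝ × ℝ}
    (hz : z ∈ segment ℝ (toR2 e.1) (toR2 e.2)) : (v : ℝ) ≤ k * z.1 + l * z.2 := by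
  rw [segment_eq_image] at hz
  obtain ⟨s, ⟨hs0, hs1⟩, rfl⟩ := hz
  simp only [toR2, Prod.smul_mk, Prod.mk_add_mk, smul_eq_mul]
  have h1' : (v : ℝ) ≤ k * e.1.1 + l * e.1.2 := by exact_mod_cast h1
  have h2' : (v : ℝ) ≤ k * e.2.1 + l * e.2.2 := by exact_mod_cast h2
  nlinarith

theorem nonCrossing_of_lt_left {e e' : (ℤ × ℤ) × (ℤ × ℤ)} (k l v : ℤ)
    (h1 : k * e.1.1 + l * e.1.2 ≤ v) (h2 : k * e.2.1 + l * e.2.2 ≤ v)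
    (h3 : v ≤ k * e'.1.1 + l * e'.1.2) (h4 : v ≤ k * e'.2.1 + l * e'.2.2)
    (hlt : k * e.1.1 + l * e.1.2 < v ∨ k * e.2.1 + l * e.2.2 < v)
    (he' : Primitive e') : NonCrossing e e' := by
  rintro z ⟨hz, hz'⟩
  rcases eq_endpoint_of_le h1 h2 hlt hz (le_of_mem_segment h3 h4 hz') with rfl | rfl
  · rcases he'.eq_or_eq hz' with h | h <;> simp [h]
  · rcases he'.eq_or_eq hz' with h | h <;> simp [h]

theorem nonCrossing_of_lt_right {e e' : (ℤ × ℤ) × (ℤ × ℤ)} (k l v : ℤ)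
    (h1 : k * e.1.1 + l * e.1.2 ≤ v) (h2 : k * e.2.1 + l * e.2.2 ≤ v)
    (h3 : v ≤ k * e'.1.1 + l * e'.1.2) (h4 : v ≤ k * e'.2.1 + l * e'.2.2)
    (hlt : v < k * e'.1.1 + l * e'.1.2 ∨ v < k * e'.2.1 + l * e'.2.2)
    (he : Primitive e) : NonCrossing e e' := by
  apply NonCrossing.symm
  apply nonCrossing_of_lt_left (-k) (-l) (-v) <;> first | linarith | exact he | skip
  rcases hlt with h | h
  · left; linarith
  · right; linarith

theorem edges_append (l : List (ℤ × ℤ)) (v : ℤ × ℤ) (l' : List (ℤ × ℤ)) :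
    edges (l ++ v :: l') = edges (l ++ [v]) ++ edges (v :: l') := by
  induction l with
  | nil => simp [edges]
  | cons a l ih =>
    cases l with
    | nil => simp [edges]
    | cons b l => simpa [edges] using ih

theorem edges_reverse (l : List (ℤ × ℤ)) :
    edges l.reverse = ((edges l).map Prod.swap).reverse := by
  induction l with
  | nil => simp [edges]
  | cons a l ih =>
    cases l with
    | nil => simp [edges]
    | cons b l =>
      have h : (a :: b :: l).reverse = l.reverse ++ b :: [a] := by simp
      rw [h, edges_append]
      have h' : l.reverse ++ [b] = (b :: l).reverse := by simp
      rw [h', ih]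
      simp [edges]

theorem edges_eq_zip (l : List (ℤ × ℤ)) : edges l = l.zip l.tail := by
  induction l with
  | nil => simp [edges]
  | cons a l ih =>
    cases l with
    | nil => simp [edges]
    | cons b l => simpa [edges] using ih

theorem mem_of_mem_edges {l : List (ℤ × ℤ)} {e : (ℤ × ℤ) × (ℤ × ℤ)} (h : e ∈ edges l) :
    e.1 ∈ l ∧ e.2 ∈ l := by
  rw [edges_eq_zip] at h
  exact ⟨(List.of_mem_zip h).1, List.mem_of_mem_tail (List.of_mem_zip h).2⟩

theorem weight_append (l : List (ℤ × ℤ)) (v : ℤ × ℤ) (l' : List (ℤ × ℤ)) :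
    weight (l ++ v :: l') = weight (l ++ [v]) + weight (v :: l') := by
  simp [weight, edges_append l v l']

theorem weight_cons_cons (a b : ℤ × ℤ) (l : List (ℤ × ℤ)) :
    weight (a :: b :: l) = sqLen a b + weight (b :: l) := by
  simp [weight, edges]

theorem sqLen_comm (a b : ℤ × ℤ) : sqLen a b = sqLen b a := by
  unfold sqLen
  rw [← Int.natAbs_neg (b.1 - a.1), neg_sub, ← Int.natAbs_neg (b.2 - a.2), neg_sub]

theorem weight_reverse (l : List (ℤ × ℤ)) : weight l.reverse = weight l := by
  simp only [weight, edges_reverse, List.map_reverse, List.sum_reverse, List.map_map]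
  congr 2
  ext e
  exact sqLen_comm _ _

theorem IsSimplePath.tail {a : ℤ × ℤ} {l : List (ℤ × ℤ)} (h : IsSimplePath (a :: l)) :
    IsSimplePath l := by
  cases l with
  | nil => exact ⟨by simp, by simp [edges], by simp [edges]⟩
  | cons b l =>
    refine ⟨h.nodup.of_cons, ?_, ?_⟩
    · have := h.nonCrossing
      rw [edges, List.pairwise_cons] at this
      exact this.2
    · intro e he
      exact h.primitive e (by rw [edges]; exact List.mem_cons_of_mem _ he)

theorem IsSimplePath.cons {a b : ℤ × ℤ} {l : List (ℤ × ℤ)} (h : IsSimplePath (b :: l))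
    (ha : a ∉ b :: l) (hp : Primitive (a, b))
    (hc : ∀ e ∈ edges (b :: l), NonCrossing (a, b) e) : IsSimplePath (a :: b :: l) := by
  refine ⟨List.nodup_cons.2 ⟨ha, h.nodup⟩, ?_, ?_⟩
  · rw [edges, List.pairwise_cons]
    exact ⟨hc, h.nonCrossing⟩
  · rw [edges]
    simpa [hp] using h.primitive

theorem IsSimplePath.reverse {l : List (ℤ × ℤ)} (h : IsSimplePath l) :
    IsSimplePath l.reverse := by
  refine ⟨List.nodup_reverse.2 h.nodup, ?_, ?_⟩
  · rw [edges_reverse, List.pairwise_reverse, List.pairwise_map]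
    exact h.nonCrossing.imp fun h => h.symm.swap
  · intro e he
    rw [edges_reverse, List.mem_reverse, List.mem_map] at he
    obtain ⟨e', he', rfl⟩ := he
    exact (h.primitive e' he').swap

theorem IsSimplePath.append {l : List (ℤ × ℤ)} {v : ℤ × ℤ} {l' : List (ℤ × ℤ)}
    (h : IsSimplePath (l ++ [v])) (h' : IsSimplePath (v :: l'))
    (hd : ∀ z ∈ l ++ [v], z ∉ l')
    (hc : ∀ e ∈ edges (l ++ [v]), ∀ e' ∈ edges (v :: l'), NonCrossing e e') :
    IsSimplePath (l ++ v :: l') := by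
  refine ⟨?_, ?_, ?_⟩
  · have : l ++ v :: l' = (l ++ [v]) ++ l' := by simp
    rw [this, List.nodup_append']
    exact ⟨h.nodup, h'.nodup.of_cons, fun z hz hz' => hd z hz hz'⟩
  · rw [edges_append, List.pairwise_append]
    exact ⟨h.nonCrossing, h'.nonCrossing, hc⟩
  · intro e he
    rw [edges_append, List.mem_append] at he
    exact he.elim (h.primitive e) (h'.primitive e)

/-- The straight path `b, b + w, …, b + m w`. -/
def run (w : ℤ × ℤ) : ℤ × ℤ → ℕ → List (ℤ × ℤ)
  | b, 0 => [b]
  | b, m + 1 => b :: run w (b + w) m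

/-- The zigzag `a, b, a + w, b + w, …, a + t w, b + t w`, followed by `m` further steps `w`. -/
def ladder (w : ℤ × ℤ) : ℤ × ℤ → ℤ × ℤ → ℕ → ℕ → List (ℤ × ℤ)
  | a, b, 0, m => a :: run w b m
  | a, b, t + 1, m => a :: b :: ladder w (a + w) (b + w) t m

theorem run_eq_cons (w b : ℤ × ℤ) (m : ℕ) : ∃ l, run w b m = b :: l := by
  cases m <;> simp [run]

theorem ladder_eq_cons (w a b : ℤ × ℤ) (t m : ℕ) : ∃ l, ladder w a b t m = a :: b :: l := by
  cases t with
  | zero => obtain ⟨l, hl⟩ := run_eq_cons w b m; exact ⟨l, by rw [ladder, hl]⟩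
  | succ t => exact ⟨_, rfl⟩

theorem mem_run {w b z : ℤ × ℤ} {m : ℕ} :
    z ∈ run w b m ↔ ∃ i : ℕ, i ≤ m ∧ z.1 = b.1 + i * w.1 ∧ z.2 = b.2 + i * w.2 := by
  induction m generalizing b with
  | zero => simp [run, Prod.ext_iff]
  | succ m ih =>
    rw [run, List.mem_cons, ih]
    constructor
    · rintro (rfl | ⟨i, hi, h1, h2⟩)
      · exact ⟨0, by simp⟩
      · refine ⟨i + 1, by omega, ?_, ?_⟩
        · rw [h1]; simp; ring
        · rw [h2]; simp; ring
    · rintro ⟨i, hi, h1, h2⟩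
      cases i with
      | zero => left; ext <;> simp [h1, h2]
      | succ i =>
        right
        refine ⟨i, by omega, ?_, ?_⟩
        · rw [h1]; simp; ring
        · rw [h2]; simp; ring

theorem mem_ladder {w a b z : ℤ × ℤ} {t m : ℕ} :
    z ∈ ladder w a b t m ↔
      (∃ i : ℕ, i ≤ t ∧ z.1 = a.1 + i * w.1 ∧ z.2 = a.2 + i * w.2) ∨
        ∃ i : ℕ, i ≤ t + m ∧ z.1 = b.1 + i * w.1 ∧ z.2 = b.2 + i * w.2 := by
  induction t generalizing a b with
  | zero => simp [ladder, mem_run, Prod.ext_iff]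
  | succ t ih =>
    rw [ladder, List.mem_cons, List.mem_cons, ih]
    constructor
    · rintro (rfl | rfl | ⟨i, hi, h1, h2⟩ | ⟨i, hi, h1, h2⟩)
      · exact Or.inl ⟨0, by simp⟩
      · exact Or.inr ⟨0, by simp⟩
      · refine Or.inl ⟨i + 1, by omega, ?_, ?_⟩
        · rw [h1]; simp; ring
        · rw [h2]; simp; ring
      · refine Or.inr ⟨i + 1, by omega, ?_, ?_⟩
        · rw [h1]; simp; ring
        · rw [h2]; simp; ring
    · rintro (⟨i, hi, h1, h2⟩ | ⟨i, hi, h1, h2⟩)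
      · cases i with
        | zero => left; ext <;> simp [h1, h2]
        | succ i =>
          refine Or.inr (Or.inr (Or.inl ⟨i, by omega, ?_, ?_⟩))
          · rw [h1]; simp; ring
          · rw [h2]; simp; ring
      · cases i with
        | zero => right; left; ext <;> simp [h1, h2]
        | succ i =>
          refine Or.inr (Or.inr (Or.inr ⟨i, by omega, ?_, ?_⟩))
          · rw [h1]; simp; ring
          · rw [h2]; simp; ring

theorem ladder_getLast (w a b : ℤ × ℤ) (t m : ℕ) :
    ∃ l, ladder w a b t m = l ++ [(b.1 + (t + m) * w.1, b.2 + (t + m) * w.2)] := by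
  have hrun : ∀ (m : ℕ) (b : ℤ × ℤ), ∃ l, run w b m = l ++ [(b.1 + m * w.1, b.2 + m * w.2)] := by
    intro m
    induction m with
    | zero => intro b; exact ⟨[], by simp [run]⟩
    | succ m ih =>
      intro b
      obtain ⟨l, hl⟩ := ih (b + w)
      refine ⟨b :: l, ?_⟩
      rw [run, hl]
      have h1 : (b + w).1 + m * w.1 = b.1 + ((m + 1 : ℕ) : ℤ) * w.1 := by simp; ring
      have h2 : (b + w).2 + m * w.2 = b.2 + ((m + 1 : ℕ) : ℤ) * w.2 := by simp; ring
      rw [h1, h2, List.cons_append]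
  induction t generalizing a b with
  | zero =>
    obtain ⟨l, hl⟩ := hrun m b
    exact ⟨a :: l, by rw [ladder, hl]; simp⟩
  | succ t ih =>
    obtain ⟨l, hl⟩ := ih (a + w) (b + w)
    refine ⟨a :: b :: l, ?_⟩
    rw [ladder, hl]
    have h1 : (b + w).1 + (t + m) * w.1 = b.1 + ((t + 1 : ℕ) + m) * w.1 := by simp; ring
    have h2 : (b + w).2 + (t + m) * w.2 = b.2 + ((t + 1 : ℕ) + m) * w.2 := by simp; ring
    rw [h1, h2, List.cons_append, List.cons_append]

theorem ladder_tail_getLast (w a b : ℤ × ℤ) (t m : ℕ) :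
    ∃ l, (ladder w a b t m).tail = l ++ [(b.1 + (t + m) * w.1, b.2 + (t + m) * w.2)] := by
  obtain ⟨r, hr⟩ := ladder_eq_cons w a b t m
  obtain ⟨l, hl⟩ := ladder_getLast w a b t m
  cases l with
  | nil => simp [hr] at hl
  | cons c l => exact ⟨l, by rw [hl]; rfl⟩

theorem weight_run (w b : ℤ × ℤ) (m : ℕ) : weight (run w b m) = m * sqLen 0 w := by
  induction m generalizing b with
  | zero => simp [run, weight, edges]
  | succ m ih =>
    have h := ih (b + w)
    obtain ⟨l, hl⟩ := run_eq_cons w (b + w) m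
    rw [hl] at h
    rw [run, hl, weight_cons_cons, h]
    simp [sqLen]
    ring

theorem weight_ladder (w a b : ℤ × ℤ) (t m : ℕ) :
    weight (ladder w a b t m) =
      (t + 1) * sqLen a b + t * sqLen (a + w) b + m * sqLen 0 w := by
  induction t generalizing a b with
  | zero =>
    have h := weight_run w b m
    obtain ⟨l, hl⟩ := run_eq_cons w b m
    rw [hl] at h
    rw [ladder, hl, weight_cons_cons, h]
    ring
  | succ t ih =>
    have h := ih (a + w) (b + w)
    obtain ⟨l, hl⟩ := ladder_eq_cons w (a + w) (b + w) t m
    rw [hl] at h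
    rw [ladder, hl, weight_cons_cons, weight_cons_cons, h, sqLen_comm b]
    simp [sqLen]
    ring

theorem isSimplePath_run {w : ℤ × ℤ} {k l : ℤ} (hw : k * w.1 + l * w.2 = 1) (b : ℤ × ℤ) (m : ℕ) :
    IsSimplePath (run w b m) := by
  induction m generalizing b with
  | zero => exact ⟨by simp [run], by simp [run, edges], by simp [run, edges]⟩
  | succ m ih =>
    have hle : ∀ z ∈ run w (b + w) m, k * b.1 + l * b.2 + 1 ≤ k * z.1 + l * z.2 := by
      intro z hz
      obtain ⟨i, -, h1, h2⟩ := mem_run.1 hz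
      have : k * z.1 + l * z.2 = k * b.1 + l * b.2 + 1 + i := by
        rw [h1, h2]
        simp only [Prod.fst_add, Prod.snd_add]
        linear_combination (1 + (i : ℤ)) * hw
      omega
    have ih' := ih (b + w)
    obtain ⟨r, hr⟩ := run_eq_cons w (b + w) m
    rw [run]
    rw [hr] at hle ih' ⊢
    refine ih'.cons ?_ ?_ ?_
    · intro hb
      have := hle b hb
      omega
    · exact ⟨k, l, by simpa using hw⟩
    · intro e he
      have hm := mem_of_mem_edges he
      refine nonCrossing_of_lt_left k l (k * b.1 + l * b.2 + 1) (by simp) ?_ (hle _ hm.1)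
        (hle _ hm.2) (Or.inl (by simp)) (ih'.primitive e he)
      simp only [Prod.fst_add, Prod.snd_add]
      linarith

theorem IsSimplePath.ne {l : List (ℤ × ℤ)} (h : IsSimplePath l) {e : (ℤ × ℤ) × (ℤ × ℤ)}
    (he : e ∈ edges l) : e.1 ≠ e.2 := by
  intro heq
  obtain ⟨x, y, h⟩ := h.primitive e he
  simp [heq] at h

theorem isSimplePath_ladder {w a b : ℤ × ℤ} {δ : ℤ} (hδ : δ * δ = 1)
    (hw : w.1 * (b.2 - a.2) - w.2 * (b.1 - a.1) = δ) (t m : ℕ) :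
    IsSimplePath (ladder w a b t m) := by
  induction t generalizing a b with
  | zero =>
    have hrun : IsSimplePath (run w b m) :=
      isSimplePath_run (k := δ * (b.2 - a.2)) (l := -δ * (b.1 - a.1))
        (by linear_combination δ * hw + hδ) b m
    have hle : ∀ z ∈ run w b m, (-δ * w.2) * z.1 + (δ * w.1) * z.2 =
        (-δ * w.2) * a.1 + (δ * w.1) * a.2 + 1 := by
      intro z hz
      obtain ⟨i, -, h1, h2⟩ := mem_run.1 hz
      rw [h1, h2]
      linear_combination δ * hw + hδ
    rw [ladder]
    obtain ⟨r, hr⟩ := run_eq_cons w b m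
    rw [hr] at hle hrun ⊢
    have hb := hle b (by simp)
    refine hrun.cons ?_ ?_ ?_
    · intro ha
      have := hle a ha
      omega
    · exact ⟨-δ * w.2, δ * w.1, by simp only; linarith⟩
    · intro e he
      have hm := mem_of_mem_edges he
      exact nonCrossing_of_lt_left (-δ * w.2) (δ * w.1) _ (by simp only; linarith) hb.le
        (hle _ hm.1).ge (hle _ hm.2).ge (Or.inl (by simp only; linarith)) (hrun.primitive e he)
  | succ t ih =>
    have ih' := ih (a := a + w) (b := b + w) (by simpa using hw)
    have hmem := fun z => (mem_ladder (w := w) (a := a + w) (b := b + w) (z := z) (t := t)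
      (m := m)).1
    rw [ladder]
    obtain ⟨r, hr⟩ := ladder_eq_cons w (a + w) (b + w) t m
    rw [hr] at hmem ih' ⊢
    set s := (a + w) :: (b + w) :: r with hs
    -- the line through `a` and `b`
    have hab : ∀ z ∈ s, δ * (b.2 - a.2) * a.1 + -δ * (b.1 - a.1) * a.2 + 1 ≤
        δ * (b.2 - a.2) * z.1 + -δ * (b.1 - a.1) * z.2 := by
      intro z hz
      rcases hmem z hz with ⟨i, -, h1, h2⟩ | ⟨i, -, h1, h2⟩
      all_goals
        have : δ * (b.2 - a.2) * z.1 + -δ * (b.1 - a.1) * z.2 =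
            δ * (b.2 - a.2) * a.1 + -δ * (b.1 - a.1) * a.2 + 1 + i := by
          rw [h1, h2]
          simp only [Prod.fst_add, Prod.snd_add]
          linear_combination (1 + (i : ℤ)) * (δ * hw + hδ)
        omega
    have hbb : δ * (b.2 - a.2) * b.1 + -δ * (b.1 - a.1) * b.2 =
        δ * (b.2 - a.2) * a.1 + -δ * (b.1 - a.1) * a.2 := by ring
    -- the line through `b` and `a + w`
    set k := -δ * (a.2 + w.2 - b.2) with hk
    set l := δ * (a.1 + w.1 - b.1) with hl
    have hba : ∀ z ∈ s, k * b.1 + l * b.2 ≤ k * z.1 + l * z.2 ∧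
        (z ≠ a + w → k * b.1 + l * b.2 < k * z.1 + l * z.2) := by
      intro z hz
      rcases hmem z hz with ⟨i, -, h1, h2⟩ | ⟨i, -, h1, h2⟩
      · have : k * z.1 + l * z.2 = k * b.1 + l * b.2 + i := by
          rw [h1, h2, hk, hl]
          simp only [Prod.fst_add, Prod.snd_add]
          linear_combination (i : ℤ) * (δ * hw + hδ)
        refine ⟨by omega, fun hne => ?_⟩
        rcases Nat.eq_zero_or_pos i with rfl | hi
        · exact absurd (Prod.ext (by simpa using h1) (by simpa using h2)) hne
        · omega
      · have : k * z.1 + l * z.2 = k * b.1 + l * b.2 + 1 + i := by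
          rw [h1, h2, hk, hl]
          simp only [Prod.fst_add, Prod.snd_add]
          linear_combination (1 + (i : ℤ)) * (δ * hw + hδ)
        exact ⟨by omega, fun _ => by omega⟩
    have haw : k * (a + w).1 + l * (a + w).2 = k * b.1 + l * b.2 := by
      rw [hk, hl]
      simp only [Prod.fst_add, Prod.snd_add]
      ring
    have hb_not : b ∉ s := by
      intro hb
      have := hab b hb
      omega
    have hprim : Primitive (b, a + w) := by
      refine ⟨δ * w.2, -δ * w.1, ?_⟩
      simp only [Prod.fst_add, Prod.snd_add]
      linear_combination δ * hw + hδ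
    have hprim' : Primitive (a, b) := ⟨-δ * w.2, δ * w.1, by linear_combination δ * hw + hδ⟩
    have hbpath : IsSimplePath (b :: s) := by
      refine ih'.cons hb_not hprim fun e he => ?_
      have hm := mem_of_mem_edges he
      have hlt : e.1 ≠ a + w ∨ e.2 ≠ a + w := by
        by_contra! h
        exact ih'.ne he (h.1.trans h.2.symm)
      exact nonCrossing_of_lt_right k l (k * b.1 + l * b.2) le_rfl haw.le (hba _ hm.1).1
        (hba _ hm.2).1 (hlt.imp (hba _ hm.1).2 (hba _ hm.2).2) hprim
    have hbs : ∀ z ∈ b :: s, δ * (b.2 - a.2) * b.1 + -δ * (b.1 - a.1) * b.2 ≤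
        δ * (b.2 - a.2) * z.1 + -δ * (b.1 - a.1) * z.2 ∧
        (z ≠ b → δ * (b.2 - a.2) * b.1 + -δ * (b.1 - a.1) * b.2 <
          δ * (b.2 - a.2) * z.1 + -δ * (b.1 - a.1) * z.2) := by
      intro z hz
      rcases List.mem_cons.1 hz with rfl | hz
      · exact ⟨le_rfl, fun h => absurd rfl h⟩
      · have := hab z hz
        exact ⟨by omega, fun _ => by omega⟩
    refine hbpath.cons ?_ hprim' fun e he => ?_
    · rw [List.mem_cons, not_or]
      constructor
      · rintro rfl
        obtain ⟨x, y, h⟩ := hprim'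
        simp at h
      · intro ha
        have := hab a ha
        omega
    · have hm := mem_of_mem_edges he
      have hlt : e.1 ≠ b ∨ e.2 ≠ b := by
        by_contra! h
        exact hbpath.ne he (h.1.trans h.2.symm)
      exact nonCrossing_of_lt_right (δ * (b.2 - a.2)) (-δ * (b.1 - a.1)) _ hbb.ge le_rfl
        (hbs _ hm.1).1 (hbs _ hm.2).1 (hlt.imp (hbs _ hm.1).2 (hbs _ hm.2).2) hprim'

/-- Every edge of a ladder has an endpoint on the line of `b`. -/
theorem edges_ladder_right {w a b : ℤ × ℤ} {t m : ℕ} {k l : ℤ} (hw : k * w.1 + l * w.2 = 0)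
    {e : (ℤ × ℤ) × (ℤ × ℤ)} (he : e ∈ edges (ladder w a b t m)) :
    k * e.1.1 + l * e.1.2 = k * b.1 + l * b.2 ∨ k * e.2.1 + l * e.2.2 = k * b.1 + l * b.2 := by
  induction t generalizing a b with
  | zero =>
    rw [ladder] at he
    have hz : e.2 ∈ run w b m := by
      obtain ⟨r, hr⟩ := run_eq_cons w b m
      rw [hr] at he ⊢
      rw [edges, List.mem_cons] at he
      rcases he with rfl | he
      · simp
      · exact (mem_of_mem_edges he).2
    obtain ⟨i, -, h1, h2⟩ := mem_run.1 hz
    right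
    rw [h1, h2]
    linear_combination (i : ℤ) * hw
  | succ t ih =>
    have ih' := ih (a := a + w) (b := b + w)
    rw [ladder] at he
    obtain ⟨r, hr⟩ := ladder_eq_cons w (a + w) (b + w) t m
    rw [hr] at he ih'
    rw [edges, edges, List.mem_cons, List.mem_cons] at he
    rcases he with rfl | rfl | he
    · exact Or.inr rfl
    · exact Or.inl rfl
    · have := ih' he
      simp only [Prod.fst_add, Prod.snd_add] at this
      rcases this with h | h
      · left; linear_combination h + hw
      · right; linear_combination h + hw

theorem edges_closed (v : ℤ × ℤ) (l : List (ℤ × ℤ)) :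
    edges (v :: l ++ [v]) = (List.range (v :: l).length).map
      fun k => ((v :: l).getD k v, (v :: l).getD (k + 1) v) := by
  rw [edges_eq_zip]
  apply List.ext_getElem
  · simp
  · intro i h1 h2
    simp only [List.length_map, List.length_range] at h2
    simp only [List.getElem_zip, List.getElem_map, List.getElem_range, List.getElem_tail,
      Prod.mk.injEq]
    constructor
    · rw [List.getElem_append_left h2, List.getD_eq_getElem _ _ h2]
    · by_cases h : i + 1 < (v :: l).length
      · rw [List.getElem_append_left h, List.getD_eq_getElem _ _ h]
      · rw [List.getElem_append_right (by omega), List.getD_eq_default _ _ (by omega)]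
        simp

theorem bddAbove_polyWeight (n : ℕ) :
    BddAbove {w : ℕ | ∃ f, IsSimpleClosedGridPolygon n f ∧ polyWeight n f = w} := by
  refine ⟨n ^ 2 * (n ^ 2 + n ^ 2), ?_⟩
  rintro w ⟨f, hf, rfl⟩
  have hle : ∀ i j, sqLen (f i) (f j) ≤ n ^ 2 + n ^ 2 := by
    intro i j
    have hi : f i ∈ gridSet n := hf.range_eq ▸ Set.mem_range_self i
    have hj : f j ∈ gridSet n := hf.range_eq ▸ Set.mem_range_self j
    obtain ⟨h1, h2, h3, h4⟩ := hi
    obtain ⟨h5, h6, h7, h8⟩ := hj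
    unfold sqLen
    gcongr <;> omega
  calc polyWeight n f ≤ ∑ i ∈ Finset.range (n ^ 2), (n ^ 2 + n ^ 2) :=
        Finset.sum_le_sum fun i _ => hle _ _
    _ = _ := by simp

theorem length_of_mem_iff {n : ℕ} {l : List (ℤ × ℤ)} (hnd : l.Nodup)
    (hmem : ∀ z, z ∈ l ↔ z ∈ gridSet n) : l.length = n ^ 2 := by
  have h : l.toFinset = Finset.Icc (1 : ℤ) n ×ˢ Finset.Icc (1 : ℤ) n := by
    ext z
    rw [List.mem_toFinset, hmem]
    simp [gridSet]
    tauto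
  rw [← List.toFinset_card_of_nodup hnd, h, Finset.card_product]
  simp [sq]

/-- A closed walk through the whole grid whose edges do not cross bounds `a(n)` from below. -/
theorem weight_le_polyA {n : ℕ} (hn : 2 ≤ n) {v : ℤ × ℤ} {l : List (ℤ × ℤ)}
    (hnd : (v :: l).Nodup) (hmem : ∀ z, z ∈ v :: l ↔ z ∈ gridSet n)
    (hnc : (edges (v :: l ++ [v])).Pairwise NonCrossing) :
    weight (v :: l ++ [v]) ≤ polyA n := by
  have hlen := length_of_mem_iff hnd hmem
  have hN : 1 < n ^ 2 := by nlinarith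
  have : NeZero (n ^ 2) := ⟨by omega⟩
  have : Fact (1 < n ^ 2) := ⟨hN⟩
  set g : ℕ → ℤ × ℤ := fun k => (v :: l).getD k v with hg
  set f : ZMod (n ^ 2) → ℤ × ℤ := fun i => g i.val with hf
  have hedges := edges_closed v l
  rw [hlen] at hedges
  have hsucc : ∀ i : ZMod (n ^ 2), f (i + 1) = g (i.val + 1) := by
    intro i
    have hi := ZMod.val_lt i
    have h1 := ZMod.val_add i 1
    rw [ZMod.val_one] at h1
    simp only [hf]
    rw [h1]
    rcases Nat.lt_or_ge (i.val + 1) (n ^ 2) with h | h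
    · rw [Nat.mod_eq_of_lt h]
    · have h' : i.val + 1 = n ^ 2 := by omega
      rw [h', Nat.mod_self]
      simp only [hg]
      rw [List.getD_eq_default (n := n ^ 2) _ _ hlen.le]
      rfl
  have hgN : ∀ k (hk : k < n ^ 2), g k = (v :: l)[k]'(by omega) := by
    intro k hk
    exact List.getD_eq_getElem _ _ _
  refine le_csSup (bddAbove_polyWeight n) ⟨f, ⟨?_, ?_, ?_⟩, ?_⟩
  · intro i j hij
    simp only [hf] at hij
    rw [hgN _ (ZMod.val_lt i), hgN _ (ZMod.val_lt j)] at hij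
    exact ZMod.val_injective _ ((List.Nodup.getElem_inj_iff hnd).1 hij)
  · ext z
    rw [← hmem, List.mem_iff_getElem]
    constructor
    · rintro ⟨i, rfl⟩
      exact ⟨i.val, by rw [hlen]; exact ZMod.val_lt i, (hgN _ (ZMod.val_lt i)).symm⟩
    · rintro ⟨k, hk, rfl⟩
      rw [hlen] at hk
      refine ⟨(k : ZMod (n ^ 2)), ?_⟩
      simp only [hf]
      rw [ZMod.val_cast_of_lt hk, hgN k hk]
  · rw [hedges, List.pairwise_map] at hnc
    have key : ∀ a b, a < b → b < n ^ 2 → NonCrossing (g a, g (a + 1)) (g b, g (b + 1)) := by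
      intro a b hab hb
      have := List.pairwise_iff_getElem.1 hnc a b (by simp; omega) (by simpa using hb) hab
      simp only [List.getElem_range] at this
      exact this
    have hne : ∀ i j : ZMod (n ^ 2), i ≠ j → NonCrossing (f i, f (i + 1)) (f j, f (j + 1)) := by
      intro i j hij
      rw [hsucc, hsucc]
      rcases lt_trichotomy i.val j.val with h | h | h
      · exact key _ _ h (ZMod.val_lt j)
      · exact absurd (ZMod.val_injective _ h) hij
      · exact (key _ _ h (ZMod.val_lt i)).symm
    exact hne
  · rw [weight, hedges, List.map_map]
    unfold polyWeight
    refine (Finset.sum_congr rfl fun k hk => ?_).trans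
      (show ∑ k ∈ Finset.range (n ^ 2), sqLen (g k) (g (k + 1)) = _ from rfl)
    rw [hsucc]
    simp only [hf]
    rw [ZMod.val_cast_of_lt (Finset.mem_range.1 hk)]

/-- The lattice points of the antidiagonal `x + y = j + 3`, numbered from the lower right. -/
def diagPoint (X : ℕ → ℤ) (j : ℕ) (i : ℤ) : ℤ × ℤ := (X j - i, j + 3 - X j + i)

/-- The zigzag between the last `T j` points of the `j`-th antidiagonal and the first points of
the next one, of which it leaves out the last `T (j + 1)`. -/
def strip (X : ℕ → ℤ) (k T : ℕ → ℕ) (j : ℕ) : List (ℤ × ℤ) :=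
  ladder (-1, 1) (diagPoint X j (k j - 1 - T j)) (diagPoint X (j + 1) 0) (T j)
    (k (j + 1) - 1 - T j - T (j + 1))

/-- The path that sweeps over the antidiagonals `0, …, j`, where the `j`-th one has `k j` points
starting at abscissa `X j`. -/
def snake (X : ℕ → ℤ) (k T : ℕ → ℕ) : ℕ → List (ℤ × ℤ)
  | 0 => [diagPoint X 0 0]
  | j + 1 => snake X k T j ++ (strip X k T j).tail

section Snake

variable {X : ℕ → ℤ} {k T : ℕ → ℕ}

theorem strip_eq_cons (X : ℕ → ℤ) (k T : ℕ → ℕ) (j : ℕ) :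
    ∃ r, strip X k T j =
      diagPoint X j (k j - 1 - T j) :: diagPoint X (j + 1) 0 :: r :=
  ladder_eq_cons _ _ _ _ _

theorem mem_strip {j : ℕ} (hj : T j + 1 ≤ k j) (h : T j + T (j + 1) + 1 ≤ k (j + 1))
    {z : ℤ × ℤ} :
    z ∈ strip X k T j ↔
      (∃ i : ℕ, k j ≤ i + 1 + T j ∧ i < k j ∧ z = diagPoint X j i) ∨
        ∃ i : ℕ, i + T (j + 1) < k (j + 1) ∧ z = diagPoint X (j + 1) i := by
  rw [strip, mem_ladder]
  simp only [diagPoint, Prod.ext_iff]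
  refine or_congr ⟨?_, ?_⟩ ⟨?_, ?_⟩
  · rintro ⟨i, hi, h1, h2⟩
    exact ⟨k j - 1 - T j + i, by omega, by omega, by omega, by omega⟩
  · rintro ⟨i, hi, hi', h1, h2⟩
    exact ⟨i + 1 + T j - k j, by omega, by omega, by omega⟩
  · rintro ⟨i, hi, h1, h2⟩
    exact ⟨i, by omega, by omega, by omega⟩
  · rintro ⟨i, hi, h1, h2⟩
    exact ⟨i, by omega, by omega, by omega⟩

theorem snake_eq_cons (X : ℕ → ℤ) (k T : ℕ → ℕ) (j : ℕ) :
    ∃ r, snake X k T j = diagPoint X 0 0 :: r := by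
  induction j with
  | zero => exact ⟨[], rfl⟩
  | succ j ih =>
    obtain ⟨r, hr⟩ := ih
    exact ⟨_, by rw [snake, hr, List.cons_append]⟩

theorem snake_eq_append (h0 : k 0 = 1) (hT0 : T 0 = 0) {j : ℕ}
    (h : ∀ i < j, T i + T (i + 1) + 1 ≤ k (i + 1)) :
    ∃ r, snake X k T j = r ++ [diagPoint X j (k j - 1 - T j)] := by
  cases j with
  | zero => exact ⟨[], by simp [snake, h0, hT0]⟩
  | succ j =>
    obtain ⟨r, hr⟩ := ladder_tail_getLast (-1, 1) (diagPoint X j (k j - 1 - T j))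
      (diagPoint X (j + 1) 0) (T j) (k (j + 1) - 1 - T j - T (j + 1))
    refine ⟨snake X k T j ++ r, ?_⟩
    rw [snake, strip, hr, List.append_assoc]
    have := h j (Nat.lt_succ_self j)
    simp only [diagPoint, List.append_cancel_left_eq, List.cons.injEq, Prod.mk.injEq, and_true]
    omega

theorem weight_snake_succ (h0 : k 0 = 1) (hT0 : T 0 = 0) {j : ℕ}
    (h : ∀ i < j, T i + T (i + 1) + 1 ≤ k (i + 1)) :
    weight (snake X k T (j + 1)) = weight (snake X k T j) + weight (strip X k T j) := by
  obtain ⟨r, hr⟩ := strip_eq_cons X k T j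
  obtain ⟨r', hr'⟩ := snake_eq_append (X := X) h0 hT0 h
  rw [snake, hr, hr', List.tail_cons, List.append_assoc, List.singleton_append, weight_append]

theorem mem_snake (h0 : k 0 = 1) (hT0 : T 0 = 0) {j : ℕ}
    (h : ∀ i < j, T i + T (i + 1) + 1 ≤ k (i + 1)) {z : ℤ × ℤ} :
    z ∈ snake X k T j ↔ ∃ j' i : ℕ,
      (j' < j ∧ i < k j' ∨ j' = j ∧ i + T j < k j) ∧ z = diagPoint X j' i := by
  induction j with
  | zero =>
    simp only [snake, List.mem_singleton]
    constructor
    · rintro rfl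
      exact ⟨0, 0, by omega, rfl⟩
    · rintro ⟨j', i, hi, rfl⟩
      obtain ⟨rfl, rfl⟩ : j' = 0 ∧ i = 0 := by omega
      rfl
  | succ j ih =>
    have hk : T j + 1 ≤ k j := by
      cases j with
      | zero => omega
      | succ j => have := h j (by omega); omega
    have hmem : z ∈ snake X k T (j + 1) ↔ z ∈ snake X k T j ∨ z ∈ strip X k T j := by
      obtain ⟨r, hr⟩ := strip_eq_cons X k T j
      obtain ⟨r', hr'⟩ := snake_eq_append (X := X) h0 hT0 (j := j) fun i hi => h i (by omega)
      rw [snake, hr, hr']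
      simp only [List.tail_cons, List.mem_append, List.mem_cons]
      tauto
    rw [hmem, ih fun i hi => h i (by omega), mem_strip hk (h j (by omega))]
    constructor
    · rintro (⟨j', i, hi, rfl⟩ | ⟨i, hi, hi', rfl⟩ | ⟨i, hi, rfl⟩)
      · exact ⟨j', i, by rcases hi with hi | ⟨rfl, hi⟩ <;> omega, rfl⟩
      · exact ⟨j, i, by omega, rfl⟩
      · exact ⟨j + 1, i, by omega, rfl⟩
    · rintro ⟨j', i, ⟨hj, hi⟩ | ⟨rfl, hi⟩, rfl⟩
      · rcases Nat.lt_succ_iff_lt_or_eq.1 hj with hj | rfl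
        · exact Or.inl ⟨j', i, by omega, rfl⟩
        · by_cases hi' : i + T j' < k j'
          · exact Or.inl ⟨j', i, by omega, rfl⟩
          · exact Or.inr (Or.inl ⟨i, by omega, by omega, rfl⟩)
      · exact Or.inr (Or.inr ⟨i, by omega, rfl⟩)

theorem isSimplePath_snake (h0 : k 0 = 1) (hT0 : T 0 = 0) {j : ℕ}
    (h : ∀ i < j, T i + T (i + 1) + 1 ≤ k (i + 1)) : IsSimplePath (snake X k T j) := by
  induction j with
  | zero => exact ⟨by simp [snake], by simp [snake, edges], by simp [snake, edges]⟩
  | succ j ih =>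
    have hk : T j + 1 ≤ k j := by
      cases j with
      | zero => omega
      | succ j => have := h j (by omega); omega
    have h' : ∀ i < j, T i + T (i + 1) + 1 ≤ k (i + 1) := fun i hi => h i (by omega)
    have ih' := ih h'
    have hstrip : IsSimplePath (strip X k T j) := by
      refine isSimplePath_ladder (δ := -1) (by norm_num) ?_ _ _
      simp only [diagPoint]
      push_cast
      ring
    have hle : ∀ z ∈ snake X k T j, 1 * z.1 + 1 * z.2 ≤ (j : ℤ) + 3 := by
      intro z hz
      obtain ⟨j', i, hj, rfl⟩ := (mem_snake h0 hT0 h').1 hz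
      simp only [diagPoint]
      omega
    have hge : ∀ z ∈ strip X k T j, (j : ℤ) + 3 ≤ 1 * z.1 + 1 * z.2 := by
      intro z hz
      rcases (mem_strip hk (h j (by omega))).1 hz with ⟨i, -, -, rfl⟩ | ⟨i, -, rfl⟩ <;>
      · simp only [diagPoint]
        omega
    have hlt : ∀ e ∈ edges (strip X k T j), (j : ℤ) + 3 < 1 * e.1.1 + 1 * e.1.2 ∨
        (j : ℤ) + 3 < 1 * e.2.1 + 1 * e.2.2 := by
      intro e he
      have := edges_ladder_right (k := 1) (l := 1) (by norm_num) he
      simp only [diagPoint] at this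
      omega
    have hnot : ∀ z ∈ snake X k T j, z ∉ (strip X k T j).tail := by
      intro z hz hz'
      obtain ⟨j', i, hj, rfl⟩ := (mem_snake h0 hT0 h').1 hz
      have hn := hstrip.nodup
      have hm := (mem_strip hk (h j (by omega))).1 (List.mem_of_mem_tail hz')
      obtain ⟨r, hr⟩ := strip_eq_cons X k T j
      rw [hr] at hn hz'
      have hne : diagPoint X j' i ≠ diagPoint X j (k j - 1 - T j) :=
        fun heq => (List.nodup_cons.1 hn).1 (heq ▸ hz')
      simp only [diagPoint, Prod.ext_iff, ne_eq] at hm hne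
      rcases hm with ⟨i', hi, hi', h1, h2⟩ | ⟨i', hi, h1, h2⟩
      · obtain rfl : j' = j := by omega
        omega
      · omega
    obtain ⟨r, hr⟩ := strip_eq_cons X k T j
    obtain ⟨r', hr'⟩ := snake_eq_append (X := X) h0 hT0 (j := j) h'
    rw [hr'] at ih' hle hnot
    rw [hr] at hstrip hge hlt hnot
    rw [snake, hr, hr', List.tail_cons, List.append_assoc, List.singleton_append]
    refine ih'.append hstrip hnot fun e he e' he' => ?_
    have hm := mem_of_mem_edges he
    have hm' := mem_of_mem_edges he'
    exact nonCrossing_of_lt_right 1 1 _ (hle _ hm.1) (hle _ hm.2) (hge _ hm'.1) (hge _ hm'.2)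
      (hlt _ he') (ih'.primitive e he)

end Snake

/-- The path along a side of the grid with `t` fjords: it starts in the corner `b`, zigzags
between the outermost line `b + ℤ w` and the neighbouring line `b + u + ℤ w`, runs along the
outermost line to its end and finally steps inwards. -/
def side (w u b : ℤ × ℤ) (s t : ℕ) : List (ℤ × ℤ) :=
  (ladder w (b.1 + u.1 + s * w.1, b.2 + u.2 + s * w.2) b t (s + 1)).tail ++
    [(b.1 + u.1 + (s + t + 1) * w.1, b.2 + u.2 + (s + t + 1) * w.2)]

theorem side_eq_append (w u b : ℤ × ℤ) (s t : ℕ) : ∃ r,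
    (ladder w (b.1 + u.1 + s * w.1, b.2 + u.2 + s * w.2) b t (s + 1)).tail =
      r ++ [(b.1 + (s + t + 1) * w.1, b.2 + (s + t + 1) * w.2)] ∧
    side w u b s t = r ++ (b.1 + (s + t + 1) * w.1, b.2 + (s + t + 1) * w.2) ::
      [(b.1 + u.1 + (s + t + 1) * w.1, b.2 + u.2 + (s + t + 1) * w.2)] := by
  obtain ⟨r, hr⟩ := ladder_tail_getLast w (b.1 + u.1 + s * w.1, b.2 + u.2 + s * w.2) b t (s + 1)
  have h : (t : ℤ) + (s + 1 : ℕ) = s + t + 1 := by push_cast; ring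
  rw [h] at hr
  exact ⟨r, hr, by rw [side, hr]; simp⟩

theorem side_eq_cons (w u b : ℤ × ℤ) (s t : ℕ) : ∃ r, side w u b s t =
    b :: (r ++ [(b.1 + u.1 + (s + t + 1) * w.1, b.2 + u.2 + (s + t + 1) * w.2)]) := by
  obtain ⟨r, hr⟩ := ladder_eq_cons w (b.1 + u.1 + s * w.1, b.2 + u.2 + s * w.2) b t (s + 1)
  exact ⟨r, by rw [side, hr]; rfl⟩

section Side

variable {w u b : ℤ × ℤ} {s t : ℕ}

theorem isSimplePath_side_ladder (hww : w.1 * w.1 + w.2 * w.2 = 1)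
    (huu : u.1 * u.1 + u.2 * u.2 = 1) (hwu : w.1 * u.1 + w.2 * u.2 = 0) :
    IsSimplePath (ladder w (b.1 + u.1 + s * w.1, b.2 + u.2 + s * w.2) b t (s + 1)) := by
  refine isSimplePath_ladder (δ := w.2 * u.1 - w.1 * u.2) ?_ ?_ _ _
  · linear_combination (u.1 * u.1 + u.2 * u.2) * hww + huu - (w.1 * u.1 + w.2 * u.2) * hwu
  · ring

theorem mem_side_ladder (hww : w.1 * w.1 + w.2 * w.2 = 1)
    (huu : u.1 * u.1 + u.2 * u.2 = 1) (hwu : w.1 * u.1 + w.2 * u.2 = 0) {z : ℤ × ℤ} :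
    z ∈ (ladder w (b.1 + u.1 + s * w.1, b.2 + u.2 + s * w.2) b t (s + 1)).tail ↔
      (∃ i : ℕ, s < i ∧ i ≤ s + t ∧ z.1 = b.1 + u.1 + i * w.1 ∧ z.2 = b.2 + u.2 + i * w.2) ∨
        ∃ i : ℕ, i ≤ s + t + 1 ∧ z.1 = b.1 + i * w.1 ∧ z.2 = b.2 + i * w.2 := by
  have hn := (isSimplePath_side_ladder (b := b) (s := s) (t := t) hww huu hwu).nodup
  have hm := mem_ladder (w := w) (a := (b.1 + u.1 + s * w.1, b.2 + u.2 + s * w.2)) (b := b)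
    (z := z) (t := t) (m := s + 1)
  obtain ⟨r, hr⟩ := ladder_eq_cons w (b.1 + u.1 + s * w.1, b.2 + u.2 + s * w.2) b t (s + 1)
  rw [hr] at hn hm ⊢
  rw [List.tail_cons]
  rw [List.mem_cons] at hm
  constructor
  · intro hz
    rcases hm.1 (Or.inr hz) with ⟨i, hi, h1, h2⟩ | h
    · rcases Nat.eq_zero_or_pos i with rfl | hi'
      · have : z = (b.1 + u.1 + s * w.1, b.2 + u.2 + s * w.2) :=
          Prod.ext (by simpa using h1) (by simpa using h2)
        exact absurd (this ▸ hz) (List.nodup_cons.1 hn).1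
      · refine Or.inl ⟨s + i, by omega, by omega, ?_, ?_⟩
        · rw [h1]; push_cast; ring
        · rw [h2]; push_cast; ring
    · obtain ⟨i, hi, h⟩ := h
      exact Or.inr ⟨i, by omega, h⟩
  · rintro (⟨i, hi, hi', h1, h2⟩ | ⟨i, hi, h1, h2⟩)
    · refine (hm.2 (Or.inl ⟨i - s, by omega, ?_, ?_⟩)).resolve_left ?_
      · rw [h1]; push_cast [hi.le]; ring
      · rw [h2]; push_cast [hi.le]; ring
      · rintro rfl
        simp only at h1 h2
        have : (i : ℤ) = s := by
          linear_combination (s - i : ℤ) * hww - w.1 * h1 - w.2 * h2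
        omega
    · refine (hm.2 (Or.inr ⟨i, by omega, h1, h2⟩)).resolve_left ?_
      rintro rfl
      simp only at h1 h2
      have : (1 : ℤ) = 0 := by
        linear_combination u.1 * h1 + u.2 * h2 - huu - (s - i : ℤ) * hwu
      omega

theorem mem_side (hww : w.1 * w.1 + w.2 * w.2 = 1)
    (huu : u.1 * u.1 + u.2 * u.2 = 1) (hwu : w.1 * u.1 + w.2 * u.2 = 0) {z : ℤ × ℤ} :
    z ∈ side w u b s t ↔
      (∃ i : ℕ, s < i ∧ i ≤ s + t + 1 ∧ z.1 = b.1 + u.1 + i * w.1 ∧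
          z.2 = b.2 + u.2 + i * w.2) ∨
        ∃ i : ℕ, i ≤ s + t + 1 ∧ z.1 = b.1 + i * w.1 ∧ z.2 = b.2 + i * w.2 := by
  rw [side, List.mem_append, mem_side_ladder hww huu hwu, List.mem_singleton, Prod.ext_iff]
  constructor
  · rintro ((⟨i, h1, h2, h3⟩ | h) | h)
    · exact Or.inl ⟨i, h1, by omega, h3⟩
    · exact Or.inr h
    · exact Or.inl ⟨s + t + 1, by omega, le_rfl, by simpa using h⟩
  · rintro (⟨i, h1, h2, h3⟩ | h)
    · rcases Nat.lt_or_ge i (s + t + 1) with h | h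
      · exact Or.inl (Or.inl ⟨i, h1, by omega, h3⟩)
      · obtain rfl : i = s + t + 1 := by omega
        exact Or.inr (by simpa using h3)
    · exact Or.inl (Or.inr h)

theorem isSimplePath_side (hww : w.1 * w.1 + w.2 * w.2 = 1)
    (huu : u.1 * u.1 + u.2 * u.2 = 1) (hwu : w.1 * u.1 + w.2 * u.2 = 0) :
    IsSimplePath (side w u b s t) := by
  have hl := (isSimplePath_side_ladder (b := b) (s := s) (t := t) hww huu hwu)
  have hm := fun z => mem_side_ladder (b := b) (s := s) (t := t) (z := z) hww huu hwu
  obtain ⟨r, hr, hs⟩ := side_eq_append w u b s t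
  have htail : IsSimplePath
      (ladder w (b.1 + u.1 + s * w.1, b.2 + u.2 + s * w.2) b t (s + 1)).tail := by
    obtain ⟨r', hr'⟩ := ladder_eq_cons w (b.1 + u.1 + s * w.1, b.2 + u.2 + s * w.2) b t (s + 1)
    rw [hr'] at hl ⊢
    exact hl.tail
  rw [hr] at htail hm
  set p : ℤ × ℤ := (b.1 + (s + t + 1) * w.1, b.2 + (s + t + 1) * w.2) with hp
  set q : ℤ × ℤ := (b.1 + u.1 + (s + t + 1) * w.1, b.2 + u.2 + (s + t + 1) * w.2) with hq
  have hpq : Primitive (p, q) := ⟨u.1, u.2, by simp only [hp, hq]; linear_combination huu⟩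
  have hle : ∀ z ∈ r ++ [p], w.1 * z.1 + w.2 * z.2 ≤ w.1 * b.1 + w.2 * b.2 + (s + t + 1) ∧
      (z ≠ p → w.1 * z.1 + w.2 * z.2 < w.1 * b.1 + w.2 * b.2 + (s + t + 1)) := by
    intro z hz
    rcases (hm z).1 hz with ⟨i, hi, hi', h1, h2⟩ | ⟨i, hi, h1, h2⟩
    · have : w.1 * z.1 + w.2 * z.2 = w.1 * b.1 + w.2 * b.2 + i := by
        rw [h1, h2]
        linear_combination hwu + (i : ℤ) * hww
      exact ⟨by omega, fun _ => by omega⟩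
    · have : w.1 * z.1 + w.2 * z.2 = w.1 * b.1 + w.2 * b.2 + i := by
        rw [h1, h2]
        linear_combination (i : ℤ) * hww
      refine ⟨by omega, fun hne => ?_⟩
      have : i ≠ s + t + 1 := by
        rintro rfl
        exact hne (Prod.ext (by simpa using h1) (by simpa using h2))
      omega
  have hwp : w.1 * p.1 + w.2 * p.2 = w.1 * b.1 + w.2 * b.2 + (s + t + 1) := by
    simp only [hp]
    linear_combination (s + t + 1 : ℤ) * hww
  have hwq : w.1 * q.1 + w.2 * q.2 = w.1 * b.1 + w.2 * b.2 + (s + t + 1) := by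
    simp only [hq]
    linear_combination (s + t + 1 : ℤ) * hww + hwu
  have hq_not : q ∉ r ++ [p] := by
    intro hz
    rcases (hm q).1 hz with ⟨i, hi, hi', h1, h2⟩ | ⟨i, hi, h1, h2⟩
    · have : (i : ℤ) = s + t + 1 := by
        linear_combination hwq - w.1 * h1 - w.2 * h2 - hwu - (i : ℤ) * hww
      omega
    · simp only [hq] at h1 h2
      have : (1 : ℤ) = 0 := by
        linear_combination u.1 * h1 + u.2 * h2 - huu - (s + t + 1 - i : ℤ) * hwu
      omega
  rw [hs]
  have hnep : p ≠ q := fun h => hq_not (h ▸ by simp)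
  refine htail.append ?_ ?_ ?_
  · exact IsSimplePath.cons ⟨by simp, by simp [edges], by simp [edges]⟩ (by simpa using hnep)
      hpq (by simp [edges])
  · intro z hz hzq
    rw [List.mem_singleton] at hzq
    exact hq_not (hzq ▸ hz)
  · intro e he e' he'
    obtain rfl : e' = (p, q) := by simpa [edges] using he'
    have hme := mem_of_mem_edges he
    have hlt : e.1 ≠ p ∨ e.2 ≠ p := by
      by_contra! h
      exact htail.ne he (h.1.trans h.2.symm)
    exact nonCrossing_of_lt_left w.1 w.2 _ (hle _ hme.1).1 (hle _ hme.2).1 hwp.ge hwq.ge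
      (hlt.imp (hle _ hme.1).2 (hle _ hme.2).2) hpq

theorem edges_side (hwu : w.1 * u.1 + w.2 * u.2 = 0)
    {e : (ℤ × ℤ) × (ℤ × ℤ)} (he : e ∈ edges (side w u b s t)) :
    u.1 * e.1.1 + u.2 * e.1.2 = u.1 * b.1 + u.2 * b.2 ∨
      u.1 * e.2.1 + u.2 * e.2.2 = u.1 * b.1 + u.2 * b.2 := by
  obtain ⟨r, hr, hs⟩ := side_eq_append w u b s t
  rw [hs, edges_append, List.mem_append, ← hr] at he
  rcases he with he | he
  · refine edges_ladder_right (w := w)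
      (a := (b.1 + u.1 + s * w.1, b.2 + u.2 + s * w.2)) (t := t) (m := s + 1) (by linarith) ?_
    obtain ⟨r', hr'⟩ := ladder_eq_cons w (b.1 + u.1 + s * w.1, b.2 + u.2 + s * w.2) b t (s + 1)
    rw [hr'] at he ⊢
    exact List.mem_cons_of_mem _ he
  · rw [edges, edges, List.mem_singleton] at he
    left
    rw [he]
    linear_combination (s + t + 1 : ℤ) * hwu

theorem sqLen_cast (a b : ℤ × ℤ) :
    (sqLen a b : ℤ) = (b.1 - a.1) ^ 2 + (b.2 - a.2) ^ 2 := by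
  simp [sqLen]

theorem weight_side (hww : w.1 * w.1 + w.2 * w.2 = 1)
    (huu : u.1 * u.1 + u.2 * u.2 = 1) (hwu : w.1 * u.1 + w.2 * u.2 = 0) :
    (weight (side w u b s t) : ℤ) = t * (s ^ 2 + (s + 1) ^ 2) + 2 * t + s + 2 := by
  have hw := weight_ladder w (b.1 + u.1 + s * w.1, b.2 + u.2 + s * w.2) b t (s + 1)
  obtain ⟨r, hr, hs⟩ := side_eq_append w u b s t
  obtain ⟨r', hr'⟩ := ladder_eq_cons w (b.1 + u.1 + s * w.1, b.2 + u.2 + s * w.2) b t (s + 1)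
  rw [hr', List.tail_cons] at hr
  rw [hr', weight_cons_cons] at hw
  rw [hs, weight_append, ← hr, weight_cons_cons]
  have h1 : weight [(b.1 + u.1 + (s + t + 1) * w.1, b.2 + u.2 + (s + t + 1) * w.2)] = 0 := rfl
  rw [h1]
  zify at hw ⊢
  simp only [sqLen_cast, Prod.fst_add, Prod.snd_add, Prod.fst_zero, Prod.snd_zero] at hw ⊢
  linear_combination hw + (t * (s ^ 2 + (s + 1) ^ 2) + s + 1 : ℤ) * hww + (2 * t + 1 : ℤ) * huu +
    (t * (4 * s + 2) : ℤ) * hwu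

end Side

/-- The number of points on the `j`-th antidiagonal that belong to the snake. -/
def diagCard (n P Q j : ℕ) : ℕ :=
  if j = 0 then 1 else if j ≤ P then j else if j + 2 ≤ n then j + 1
  else if j + Q + 5 ≤ 2 * n then 2 * n - 3 - j else if j + 5 ≤ 2 * n then 2 * n - 4 - j else 1

/-- The abscissa of the lower right point of the snake on the `j`-th antidiagonal. -/
def diagStart (n P Q j : ℕ) : ℤ :=
  if j = 0 then 1 else if j ≤ P then j else if j + 2 ≤ n then j + 1
  else if j + Q + 5 ≤ 2 * n then n - 1 else if j + 5 ≤ 2 * n then n - 2 else n - 1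

/-- The parameter of the `j`-th strip; a third of it is spent on its fjords. -/
def stripLength (n P Q j : ℕ) : ℕ :=
  if j < P then j else if j + 3 ≤ n then j + 1
  else if j + Q + 6 ≤ 2 * n then 2 * n - 4 - j else if j + 6 ≤ 2 * n then 2 * n - 5 - j else 1

section Diagonals

variable {n P Q : ℕ}

theorem diag_cases (n P Q j : ℕ) :
    j = 0 ∧ diagCard n P Q j = 1 ∧ diagStart n P Q j = 1 ∨
    j ≠ 0 ∧ j ≤ P ∧ diagCard n P Q j = j ∧ diagStart n P Q j = j ∨
    P < j ∧ j + 2 ≤ n ∧ diagCard n P Q j = j + 1 ∧ diagStart n P Q j = j + 1 ∨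
    P < j ∧ n < j + 2 ∧ j + Q + 5 ≤ 2 * n ∧ diagCard n P Q j = 2 * n - 3 - j ∧
      diagStart n P Q j = n - 1 ∨
    P < j ∧ n < j + 2 ∧ 2 * n < j + Q + 5 ∧ j + 5 ≤ 2 * n ∧ diagCard n P Q j = 2 * n - 4 - j ∧
      diagStart n P Q j = n - 2 ∨
    P < j ∧ n < j + 2 ∧ 2 * n < j + Q + 5 ∧ 2 * n < j + 5 ∧ diagCard n P Q j = 1 ∧
      diagStart n P Q j = n - 1 := by
  unfold diagCard diagStart
  split_ifs <;> omega

theorem strip_cases (n P Q j : ℕ) :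
    j < P ∧ stripLength n P Q j = j ∨
    P ≤ j ∧ j + 3 ≤ n ∧ stripLength n P Q j = j + 1 ∨
    P ≤ j ∧ n < j + 3 ∧ j + Q + 6 ≤ 2 * n ∧ stripLength n P Q j = 2 * n - 4 - j ∨
    P ≤ j ∧ n < j + 3 ∧ 2 * n < j + Q + 6 ∧ j + 6 ≤ 2 * n ∧
      stripLength n P Q j = 2 * n - 5 - j ∨
    P ≤ j ∧ n < j + 3 ∧ 2 * n < j + Q + 6 ∧ 2 * n < j + 6 ∧ stripLength n P Q j = 1 := by
  unfold stripLength
  split_ifs <;> omega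

theorem strip_fits (hPn : P + 3 ≤ n) (hQ : 1 ≤ Q) (hQn : Q + 3 ≤ n) :
    ∀ j < 2 * n - 4, stripLength n P Q j / 3 + stripLength n P Q (j + 1) / 3 + 1 ≤
      diagCard n P Q (j + 1) := by
  intro j hj
  have h1 := strip_cases n P Q j
  have h2 := strip_cases n P Q (j + 1)
  have h3 := diag_cases n P Q (j + 1)
  generalize stripLength n P Q j = s at *
  generalize stripLength n P Q (j + 1) = t at *
  generalize diagCard n P Q (j + 1) = c at *
  generalize diagStart n P Q (j + 1) = x at *
  rcases h1 with h1 | h1 | h1 | h1 | h1 <;> rcases h2 with h2 | h2 | h2 | h2 | h2 <;>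
    first
    | exfalso; omega
    | rcases h3 with h3 | h3 | h3 | h3 | h3 | h3 <;> omega

theorem stripLength_eq (hP : 1 ≤ P) (hPn : P + 3 ≤ n) (hQ : 1 ≤ Q) (hQn : Q + 3 ≤ n) {j : ℕ}
    (hj : j < 2 * n - 4) : (stripLength n P Q j : ℤ) =
      diagStart n P Q (j + 1) - diagStart n P Q j + diagCard n P Q j - 1 := by
  have h1 := strip_cases n P Q j
  have h2 := diag_cases n P Q j
  have h3 := diag_cases n P Q (j + 1)
  generalize stripLength n P Q j = s at *
  generalize diagCard n P Q j = c at *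
  generalize diagStart n P Q j = x at *
  generalize diagCard n P Q (j + 1) = c' at *
  generalize diagStart n P Q (j + 1) = x' at *
  rcases h1 with h1 | h1 | h1 | h1 | h1 <;> rcases h2 with h2 | h2 | h2 | h2 | h2 | h2 <;>
    first
    | exfalso; omega
    | rcases h3 with h3 | h3 | h3 | h3 | h3 | h3 <;> omega

theorem exists_diagPoint_iff (hP : 1 ≤ P) (hPn : P + 3 ≤ n) (hQ : 1 ≤ Q) (hQn : Q + 3 ≤ n)
    {z : ℤ × ℤ} :
    (∃ j i : ℕ, j ≤ 2 * n - 4 ∧ i < diagCard n P Q j ∧ z = diagPoint (diagStart n P Q) j i) ↔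
      (1 ≤ z.1 ∧ z.1 < n ∧ 2 ≤ z.2 ∧ z.2 ≤ n) ∧ ¬(z.2 = 2 ∧ 2 ≤ z.1 ∧ z.1 ≤ P + 1) ∧
        ¬(z.1 = n - 1 ∧ n - Q ≤ z.2 ∧ z.2 < n) := by
  simp only [diagPoint, Prod.ext_iff]
  constructor
  · rintro ⟨j, i, hj, hi, h1, h2⟩
    have := diag_cases n P Q j
    generalize diagCard n P Q j = c at *
    generalize diagStart n P Q j = x at *
    rcases this with h | h | h | h | h | h <;> omega
  · intro h
    obtain ⟨j, hj⟩ : ∃ j : ℕ, (j : ℤ) = z.1 + z.2 - 3 := ⟨(z.1 + z.2 - 3).toNat, by omega⟩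
    have hi : z.1 ≤ diagStart n P Q j ∧ diagStart n P Q j - z.1 < diagCard n P Q j := by
      have := diag_cases n P Q j
      generalize diagCard n P Q j = c at *
      generalize diagStart n P Q j = x at *
      rcases this with h | h | h | h | h | h <;> omega
    exact ⟨j, (diagStart n P Q j - z.1).toNat, by omega, by omega, by omega, by omega⟩

end Diagonals

theorem Ugain_succ (K : ℕ) :
    ((K / 3 : ℕ) + 1 : ℤ) * ((K - (K / 3 : ℕ)) ^ 2 + (K - (K / 3 : ℕ) - 1) ^ 2) +
      (K / 3 : ℕ) * ((K - (K / 3 : ℕ) + 1) ^ 2 + (K - (K / 3 : ℕ)) ^ 2) =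
      Ugain (K + 1) + 4 * (K / 3 : ℕ) := by
  obtain ⟨s, hs⟩ : ∃ s, s = K / 3 := ⟨_, rfl⟩
  rw [← hs]
  have h : K = 3 * s ∨ K = 3 * s + 1 ∨ K = 3 * s + 2 := by omega
  unfold Ugain
  rcases h with rfl | rfl | rfl
  · have h1 : ((3 * s : ℕ) + 1 : ℤ) % 3 = 1 := by omega
    have h2 : ((3 * s : ℕ) + 1 : ℤ) / 3 = s := by omega
    rw [h1, h2]
    push_cast
    ring
  · have h1 : ((3 * s + 1 : ℕ) + 1 : ℤ) % 3 = 2 := by omega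
    have h2 : ((3 * s + 1 : ℕ) + 1 : ℤ) / 3 = s := by omega
    rw [h1, h2]
    push_cast
    ring
  · have h1 : ((3 * s + 2 : ℕ) + 1 : ℤ) % 3 = 0 := by omega
    have h2 : ((3 * s + 2 : ℕ) + 1 : ℤ) / 3 = s + 1 := by omega
    rw [h1, h2]
    push_cast
    ring

theorem weight_strip {X : ℕ → ℤ} {k T : ℕ → ℕ} {K j : ℕ} (hT : T j = K / 3)
    (hK : (K : ℤ) = X (j + 1) - X j + k j - 1) (h : T j + T (j + 1) + 1 ≤ k (j + 1)) :
    (weight (strip X k T j) : ℤ) =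
      Ugain (K + 1) + 2 * T j - 2 * T (j + 1) + 2 * (k (j + 1) - 1) := by
  have hU := Ugain_succ K
  rw [← hT] at hU
  rw [strip, weight_ladder]
  have hm : ((k (j + 1) - 1 - T j - T (j + 1) : ℕ) : ℤ) = k (j + 1) - 1 - T j - T (j + 1) := by
    omega
  push_cast
  simp only [hm, sqLen_cast, diagPoint, Prod.fst_add, Prod.snd_add, Prod.fst_zero, Prod.snd_zero]
  have h1 : X (j + 1) - 0 - (X j - (k j - 1 - T j)) = K - T j := by linarith
  have h2 : (((j + 1 : ℕ) : ℤ) + 3 - X (j + 1) + 0) - (j + 3 - X j + (k j - 1 - T j)) =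
      1 - (K - T j) := by push_cast; linarith
  have h3 : X (j + 1) - 0 - (X j - (k j - 1 - T j) + -1) = K - T j + 1 := by linarith
  have h4 : (((j + 1 : ℕ) : ℤ) + 3 - X (j + 1) + 0) - (j + 3 - X j + (k j - 1 - T j) + 1) =
      - (K - T j) := by push_cast; linarith
  rw [h1, h2, h3, h4]
  linear_combination hU

/-- The total gain of the strips of parameter less than `m`. -/
def gainSum (m : ℕ) : ℤ := ∑ K ∈ Finset.range m, Ugain (K + 1)

theorem gainSum_succ (m : ℕ) : gainSum (m + 1) = gainSum m + Ugain (m + 1) :=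
  Finset.sum_range_succ _ _

section SnakeWeight

variable {n P Q : ℕ}

theorem sum_strips (hP : 1 ≤ P) (hPn : P + 3 ≤ n) (hQ : 1 ≤ Q) (hQn : Q + 3 ≤ n) {H : ℕ → ℤ}
    (h0 : H 0 = 0) (hH : ∀ j < 2 * n - 4, H (j + 1) =
      H j + Ugain (stripLength n P Q j + 1) + 2 * (diagCard n P Q (j + 1) - 1)) :
    H (2 * n - 4) = 2 * gainSum (n - 1) - Ugain (P + 1) - Ugain (Q + 2) + 2 * (n - 2) ^ 2 -
      2 * P - 2 * Q := by
  have hstep : ∀ (j K c : ℕ), j < 2 * n - 4 → stripLength n P Q j = K →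
      diagCard n P Q (j + 1) = c → H (j + 1) = H j + Ugain (K + 1) + 2 * (c - 1) := by
    rintro j K c hj rfl rfl
    exact hH j hj
  have phase1 : ∀ j ≤ P, H j = gainSum j + j * (j - 1) := by
    intro j
    induction j with
    | zero => intro _; simp [h0, gainSum]
    | succ j ih =>
      intro hj
      rw [hstep j j (j + 1) (by omega) (by have := strip_cases n P Q j; omega)
        (by have := diag_cases n P Q (j + 1); omega), ih (by omega), gainSum_succ]
      push_cast
      ring
  have phase2 : ∀ i, P + 1 + i + 2 ≤ n → H (P + 1 + i) =
      gainSum (P + 2 + i) - Ugain (P + 1) + (P + 1 + i) * (P + 2 + i) - 2 * P := by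
    intro i
    induction i with
    | zero =>
      intro hi
      rw [add_zero, hstep P (P + 1) (P + 2) (by omega) (by have := strip_cases n P Q P; omega)
        (by have := diag_cases n P Q (P + 1); omega), phase1 P le_rfl, gainSum_succ, gainSum_succ]
      push_cast
      ring
    | succ i ih =>
      intro hi
      rw [← add_assoc, ← add_assoc, hstep (P + 1 + i) (P + 2 + i) (P + 3 + i) (by omega)
        (by have := strip_cases n P Q (P + 1 + i); omega)
        (by have := diag_cases n P Q (P + 1 + i + 1); omega), ih (by omega), gainSum_succ]
      push_cast
      ring
  obtain ⟨C, hC⟩ : ∃ C : ℤ, C = gainSum (n - 1) - Ugain (P + 1) + (n - 2) * (n - 1) - 2 * P :=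
    ⟨_, rfl⟩
  have phase3 : ∀ i r, i + r + 1 = n → Q + 2 ≤ r → H (n - 2 + i) =
      C + gainSum (n - 1) - gainSum r + (n - 3) * (n - 2) - (r - 1) * (r - 2) := by
    intro i
    induction i with
    | zero =>
      intro r hr hQr
      have h := phase2 (n - 3 - P) (by omega)
      rw [show P + 1 + (n - 3 - P) = n - 2 + 0 by omega,
        show P + 2 + (n - 3 - P) = n - 1 by omega] at h
      obtain rfl : r = n - 1 := by omega
      rw [h, hC]
      push_cast [show 1 ≤ n by omega, show 3 ≤ n by omega, show P ≤ n - 3 by omega]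
      ring
    | succ i ih =>
      intro r hr hQr
      rw [← add_assoc, hstep (n - 2 + i) r r (by omega)
        (by have := strip_cases n P Q (n - 2 + i); omega)
        (by have := diag_cases n P Q (n - 2 + i + 1); omega),
        ih (r + 1) (by omega) (by omega), gainSum_succ]
      push_cast [show 1 ≤ r by omega]
      ring
  have phase4 : ∀ i r, i + r = Q → 1 ≤ r → H (2 * n - 4 - Q + i) =
      C + gainSum (n - 1) - Ugain (Q + 2) - gainSum r + (n - 3) * (n - 2) -
        (r - 1) * (r - 2) - 2 * Q := by
    intro i
    induction i with
    | zero =>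
      intro r hr hr1
      obtain rfl : r = Q := by omega
      have h := phase3 (n - 3 - r) (r + 2) (by omega) le_rfl
      rw [show n - 2 + (n - 3 - r) = 2 * n - 5 - r by omega] at h
      rw [show 2 * n - 4 - r + 0 = 2 * n - 5 - r + 1 by omega,
        hstep (2 * n - 5 - r) r r (by omega)
        (by have := strip_cases n P r (2 * n - 5 - r); omega)
        (by have := diag_cases n P r (2 * n - 5 - r + 1); omega), h, gainSum_succ, gainSum_succ]
      push_cast
      rw [add_assoc (r : ℤ) 1 1, one_add_one_eq_two]
      ring
    | succ i ih =>
      intro r hr hr1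
      rw [← add_assoc, hstep (2 * n - 4 - Q + i) r r (by omega)
        (by have := strip_cases n P Q (2 * n - 4 - Q + i); omega)
        (by have := diag_cases n P Q (2 * n - 4 - Q + i + 1); omega),
        ih (r + 1) (by omega) (by omega), gainSum_succ]
      push_cast
      ring
  have h := phase4 (Q - 1) 1 (by omega) le_rfl
  rw [show 2 * n - 4 = 2 * n - 4 - Q + (Q - 1) + 1 by omega,
    hstep (2 * n - 4 - Q + (Q - 1)) 1 1 (by omega)
    (by have := strip_cases n P Q (2 * n - 4 - Q + (Q - 1)); omega)
    (by have := diag_cases n P Q (2 * n - 4 - Q + (Q - 1) + 1); omega), h, hC]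
  have h1 : gainSum 1 = 1 := by simp [gainSum, Ugain]
  have h2 : Ugain 2 = 1 := by simp [Ugain]
  rw [h1, Nat.cast_one, one_add_one_eq_two, h2]
  ring

theorem weight_snake (hP : 1 ≤ P) (hPn : P + 3 ≤ n) (hQ : 1 ≤ Q) (hQn : Q + 3 ≤ n) :
    (weight (snake (diagStart n P Q) (diagCard n P Q) (fun j => stripLength n P Q j / 3)
      (2 * n - 4)) : ℤ) =
      2 * gainSum (n - 1) - Ugain (P + 1) - Ugain (Q + 2) + 2 * (n - 2) ^ 2 - 2 * P - 2 * Q := by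
  set X := diagStart n P Q
  set k := diagCard n P Q with hk
  set T : ℕ → ℕ := fun j => stripLength n P Q j / 3 with hT
  have hk0 : k 0 = 1 := by simp [hk, diagCard]
  have hT0 : T 0 = 0 := by simp [hT, stripLength]; split_ifs <;> omega
  have hfit : ∀ j < 2 * n - 4, T j + T (j + 1) + 1 ≤ k (j + 1) := strip_fits hPn hQ hQn
  have hend : T (2 * n - 4) = 0 := by
    have := strip_cases n P Q (2 * n - 4)
    simp only [hT]
    omega
  rw [← sum_strips (H := fun j => weight (snake X k T j) + 2 * T j) hP hPn hQ hQn]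
  · simp [hend]
  · simp [snake, hT0, weight, edges]
  · intro j hj
    have h1 := weight_snake_succ (X := X) hk0 hT0 (j := j) fun i hi => hfit i (by omega)
    have h2 := weight_strip (T := T) rfl (stripLength_eq hP hPn hQ hQn hj) (hfit j hj)
    rw [h1]
    push_cast
    rw [h2]
    ring

end SnakeWeight

theorem two_mul_gainSum (m : ℕ) : (2 * gainSum m : ℚ) =
    betaSeq (m + 1) - 6 * (m + 1) ^ 2 + 26 * (m + 1) - 26 := by
  induction m with
  | zero => norm_num [gainSum, betaSeq, dCorr]
  | succ m ih =>
    rw [gainSum_succ]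
    have key : (2 * Ugain (m + 1) : ℚ) = betaSeq (m + 1 + 1) - betaSeq (m + 1) -
        6 * (m + 2) ^ 2 + 6 * (m + 1) ^ 2 + 26 := by
      obtain ⟨s, hs⟩ : ∃ s, s = m / 3 := ⟨_, rfl⟩
      have h : m = 3 * s ∨ m = 3 * s + 1 ∨ m = 3 * s + 2 := by omega
      unfold betaSeq Ugain dCorr
      rcases h with rfl | rfl | rfl
      · rw [show ((3 * s : ℕ) + 1 : ℤ) % 3 = 1 by omega,
          show ((3 * s : ℕ) + 1 : ℤ) / 3 = s by omega,
          show (3 * s + 1) % 3 = 1 by omega, show (3 * s + 1 + 1) % 3 = 2 by omega]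
        push_cast
        norm_num
        ring
      · rw [show ((3 * s + 1 : ℕ) + 1 : ℤ) % 3 = 2 by omega,
          show ((3 * s + 1 : ℕ) + 1 : ℤ) / 3 = s by omega,
          show (3 * s + 1 + 1) % 3 = 2 by omega, show (3 * s + 1 + 1 + 1) % 3 = 0 by omega]
        push_cast
        norm_num
        ring
      · rw [show ((3 * s + 2 : ℕ) + 1 : ℤ) % 3 = 0 by omega,
          show ((3 * s + 2 : ℕ) + 1 : ℤ) / 3 = s + 1 by omega,
          show (3 * s + 2 + 1) % 3 = 0 by omega, show (3 * s + 2 + 1 + 1) % 3 = 1 by omega]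
        push_cast
        norm_num
        ring
    push_cast
    linear_combination ih + key

theorem mem_middle {a b z : ℤ × ℤ} {r : List (ℤ × ℤ)} (h : (a :: (r ++ [b])).Nodup) :
    z ∈ r ↔ z ∈ a :: (r ++ [b]) ∧ z ≠ a ∧ z ≠ b := by
  rw [List.nodup_cons, List.nodup_append] at h
  simp only [List.mem_append, List.mem_cons, List.mem_nil_iff, or_false, not_or] at h ⊢
  constructor
  · intro hz
    refine ⟨Or.inr (Or.inl hz), ?_, h.2.2.2 z hz b rfl⟩
    rintro rfl
    exact h.1.1 hz
  · tauto

/-- The snake closes up with the paths along the right and the bottom side of the grid. -/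
theorem weight_add_le_polyA {n P Q : ℕ} (hP : 1 ≤ P) (hPn : P + 3 ≤ n) (hQ : 1 ≤ Q)
    (hQn : Q + 3 ≤ n) :
    weight (snake (diagStart n P Q) (diagCard n P Q) (fun j => stripLength n P Q j / 3)
        (2 * n - 4)) + weight (side (0, 1) (-1, 0) ((n : ℤ), 1) (n - Q - 2) Q) +
      weight (side (-1, 0) (0, 1) ((n : ℤ), 1) (n - P - 2) P) ≤ polyA n := by
  set X := diagStart n P Q with hX
  set k := diagCard n P Q with hk
  set T : ℕ → ℕ := fun j => stripLength n P Q j / 3 with hT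
  have hk0 : k 0 = 1 := by simp [hk, diagCard]
  have hT0 : T 0 = 0 := by simp [hT, stripLength]; split_ifs <;> omega
  have hfit : ∀ j < 2 * n - 4, T j + T (j + 1) + 1 ≤ k (j + 1) := strip_fits hPn hQ hQn
  have hTend : T (2 * n - 4) = 0 := by
    have := strip_cases n P Q (2 * n - 4)
    simp only [hT]
    omega
  have hend : X (2 * n - 4) = n - 1 ∧ k (2 * n - 4) = 1 := by
    have := diag_cases n P Q (2 * n - 4)
    simp only [hX, hk]
    omega
  -- the snake
  have hS := isSimplePath_snake (X := X) hk0 hT0 hfit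
  have hmS : ∀ z, z ∈ snake X k T (2 * n - 4) ↔
      (1 ≤ z.1 ∧ z.1 < n ∧ 2 ≤ z.2 ∧ z.2 ≤ n) ∧ ¬(z.2 = 2 ∧ 2 ≤ z.1 ∧ z.1 ≤ P + 1) ∧
        ¬(z.1 = n - 1 ∧ n - Q ≤ z.2 ∧ z.2 < n) := by
    intro z
    have hend' : diagCard n P Q (2 * n - 4) = 1 := hend.2
    rw [← exists_diagPoint_iff hP hPn hQ hQn, mem_snake hk0 hT0 hfit]
    refine exists_congr fun j => exists_congr fun i => ?_
    rw [← and_assoc]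
    refine and_congr_left fun _ => ?_
    constructor
    · rintro (h | ⟨rfl, h⟩)
      · exact ⟨by omega, h.2⟩
      · exact ⟨le_rfl, by omega⟩
    · rintro ⟨h1, h2⟩
      rcases h1.lt_or_eq with h | rfl
      · exact Or.inl ⟨h, h2⟩
      · exact Or.inr ⟨rfl, by omega⟩
  obtain ⟨l, hl⟩ := snake_eq_cons X k T (2 * n - 4)
  have hfirst : diagPoint X 0 0 = (1, 2) := by simp [diagPoint, hX, diagStart]
  rw [hfirst] at hl
  obtain ⟨r, hr⟩ := snake_eq_append (X := X) hk0 hT0 hfit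
  have hlast : diagPoint X (2 * n - 4) (k (2 * n - 4) - 1 - T (2 * n - 4)) =
      ((n : ℤ) - 1, (n : ℤ)) := by
    simp only [diagPoint, Prod.ext_iff]
    omega
  rw [hlast] at hr
  -- the right side
  have hR : IsSimplePath (side (0, 1) (-1, 0) ((n : ℤ), 1) (n - Q - 2) Q) :=
    isSimplePath_side (by norm_num) (by norm_num) (by norm_num)
  have hmR : ∀ z, z ∈ side (0, 1) (-1, 0) ((n : ℤ), 1) (n - Q - 2) Q ↔
      (z.1 = n - 1 ∧ n - Q ≤ z.2 ∨ z.1 = n ∧ 1 ≤ z.2) ∧ z.2 ≤ n := by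
    intro z
    rw [mem_side (by norm_num) (by norm_num) (by norm_num)]
    constructor
    · rintro (⟨i, h⟩ | ⟨i, h⟩) <;> omega
    · rintro ⟨h | h, h'⟩
      · exact Or.inl ⟨(z.2 - 1).toNat, by omega⟩
      · exact Or.inr ⟨(z.2 - 1).toNat, by omega⟩
  have heR : ∀ e ∈ edges (side (0, 1) (-1, 0) ((n : ℤ), 1) (n - Q - 2) Q),
      e.1.1 = n ∨ e.2.1 = n := by
    intro e he
    have := edges_side (by norm_num) he
    omega
  obtain ⟨a, ha⟩ := side_eq_cons (0, 1) (-1, 0) ((n : ℤ), 1) (n - Q - 2) Q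
  have hlastR : (((n : ℤ) + -1 + (((n - Q - 2 : ℕ) : ℤ) + Q + 1) * 0,
      1 + 0 + (((n - Q - 2 : ℕ) : ℤ) + Q + 1) * 1) : ℤ × ℤ) = ((n : ℤ) - 1, (n : ℤ)) := by
    simp only [Prod.ext_iff]
    omega
  simp only [hlastR] at ha
  -- the bottom side
  have hB : IsSimplePath (side (-1, 0) (0, 1) ((n : ℤ), 1) (n - P - 2) P) :=
    isSimplePath_side (by norm_num) (by norm_num) (by norm_num)
  have hmB : ∀ z, z ∈ side (-1, 0) (0, 1) ((n : ℤ), 1) (n - P - 2) P ↔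
      (z.2 = 2 ∧ z.1 ≤ P + 1 ∨ z.2 = 1 ∧ z.1 ≤ n) ∧ 1 ≤ z.1 := by
    intro z
    rw [mem_side (by norm_num) (by norm_num) (by norm_num)]
    constructor
    · rintro (⟨i, h⟩ | ⟨i, h⟩) <;> omega
    · rintro ⟨h | h, h'⟩
      · exact Or.inl ⟨(n - z.1).toNat, by omega⟩
      · exact Or.inr ⟨(n - z.1).toNat, by omega⟩
  have heB : ∀ e ∈ edges (side (-1, 0) (0, 1) ((n : ℤ), 1) (n - P - 2) P),
      e.1.2 = 1 ∨ e.2.2 = 1 := by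
    intro e he
    have := edges_side (by norm_num) he
    omega
  obtain ⟨b, hb⟩ := side_eq_cons (-1, 0) (0, 1) ((n : ℤ), 1) (n - P - 2) P
  have hlastB : (((n : ℤ) + 0 + (((n - P - 2 : ℕ) : ℤ) + P + 1) * -1,
      1 + 1 + (((n - P - 2 : ℕ) : ℤ) + P + 1) * 0) : ℤ × ℤ) = (1, 2) := by
    simp only [Prod.ext_iff]
    omega
  simp only [hlastB] at hb
  -- the closed polygon
  have hma : ∀ z, z ∈ a ↔ _ := fun z => mem_middle (ha ▸ hR.nodup)
  have hmb : ∀ z, z ∈ b ↔ _ := fun z => mem_middle (hb ▸ hB.nodup)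
  rw [← ha] at hma
  rw [← hb] at hmb
  simp only [hmR, Prod.ext_iff, ne_eq] at hma
  simp only [hmB, Prod.ext_iff, ne_eq] at hmb
  have hna : a.Nodup := by
    have := hR.nodup
    rw [ha] at this
    exact (List.nodup_append.1 this.of_cons).1
  have hnb : (((n : ℤ), 1) :: b).Nodup := by
    have := hB.nodup
    rw [hb, ← List.cons_append] at this
    exact (List.nodup_append.1 this).1
  have hwalk : (1, 2) :: (l ++ a.reverse ++ ((n : ℤ), 1) :: b) ++ [(1, 2)] =
      r ++ ((n : ℤ) - 1, (n : ℤ)) :: (a.reverse ++ ((n : ℤ), 1) :: (b ++ [(1, 2)])) := by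
    have : (1, 2) :: l = r ++ [((n : ℤ) - 1, (n : ℤ))] := hl.symm.trans hr
    calc _ = ((1, 2) :: l) ++ (a.reverse ++ ((n : ℤ), 1) :: (b ++ [(1, 2)])) := by simp
      _ = _ := by rw [this]; simp
  have hrev : (side (0, 1) (-1, 0) ((n : ℤ), 1) (n - Q - 2) Q).reverse =
      (((n : ℤ) - 1, (n : ℤ)) :: a.reverse) ++ [((n : ℤ), 1)] := by
    rw [ha]
    simp
  have hw : weight ((1, 2) :: (l ++ a.reverse ++ ((n : ℤ), 1) :: b) ++ [(1, 2)]) =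
      weight (snake X k T (2 * n - 4)) + weight (side (0, 1) (-1, 0) ((n : ℤ), 1) (n - Q - 2) Q) +
        weight (side (-1, 0) (0, 1) ((n : ℤ), 1) (n - P - 2) P) := by
    rw [hwalk, weight_append, ← List.cons_append, weight_append _ ((n : ℤ), 1), ← hr, ← hb, ← hrev,
      weight_reverse, add_assoc]
  rw [← hw]
  refine weight_le_polyA (by omega) ?_ ?_ ?_
  · rw [← List.cons_append, ← List.cons_append, ← hl, List.nodup_append, List.nodup_append]
    refine ⟨⟨hS.nodup, List.nodup_reverse.2 hna, ?_⟩, hnb, ?_⟩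
    · rintro z hz _ hz' rfl
      rw [hmS] at hz
      rw [List.mem_reverse, hma] at hz'
      omega
    · rintro z hz _ hz' rfl
      rw [List.mem_append, hmS, List.mem_reverse, hma] at hz
      rw [List.mem_cons, hmb, Prod.ext_iff] at hz'
      omega
  · intro z
    rw [← List.cons_append, ← List.cons_append, ← hl, List.mem_append, List.mem_append, hmS,
      List.mem_reverse, hma, List.mem_cons, hmb, Prod.ext_iff]
    simp only [gridSet, Set.mem_ofPred_eq]
    omega
  · rw [hwalk, edges_append, ← List.cons_append, edges_append _ ((n : ℤ), 1), ← hr, ← hb, ← hrev,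
      List.pairwise_append, List.pairwise_append]
    have heR' : ∀ e ∈ edges (side (0, 1) (-1, 0) ((n : ℤ), 1) (n - Q - 2) Q).reverse,
        e.1.1 = n ∨ e.2.1 = n := by
      intro e he
      rw [edges_reverse, List.mem_reverse, List.mem_map] at he
      obtain ⟨e', he', rfl⟩ := he
      exact (heR e' he').symm
    refine ⟨hS.nonCrossing, ⟨hR.reverse.nonCrossing, hB.nonCrossing, ?_⟩, ?_⟩
    · intro e he e' he'
      have h1 := mem_of_mem_edges he
      have h2 := mem_of_mem_edges he'
      rw [List.mem_reverse, List.mem_reverse, hmR, hmR] at h1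
      rw [hmB, hmB] at h2
      have hne := hR.reverse.ne he
      rw [Ne, Prod.ext_iff] at hne
      refine nonCrossing_of_lt_left (-1) (-1) (-((n : ℤ) + 1)) ?_ ?_ ?_ ?_ ?_
        (hB.primitive e' he') <;> omega
    · intro e he e' he'
      have h1 := mem_of_mem_edges he
      rw [hmS, hmS] at h1
      rcases List.mem_append.1 he' with he' | he'
      · have h2 := mem_of_mem_edges he'
        rw [List.mem_reverse, List.mem_reverse, hmR, hmR] at h2
        have := heR' e' he'
        refine nonCrossing_of_lt_right 1 0 ((n : ℤ) - 1) ?_ ?_ ?_ ?_ ?_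
          (hS.primitive e he) <;> omega
      · have h2 := mem_of_mem_edges he'
        rw [hmB, hmB] at h2
        have := heB e' he'
        refine nonCrossing_of_lt_right 0 (-1) (-2) ?_ ?_ ?_ ?_ ?_
          (hS.primitive e he) <;> omega

/-- For `n ≥ 9` and `1 ≤ p, q ≤ n − 3`, one has `a(n) ≥ s(n;p,q)`. -/
theorem polyA_ge_sFjord (n : ℕ) (hn : 9 ≤ n) (p q : ℤ)
    (hp1 : 1 ≤ p) (hp2 : p ≤ (n : ℤ) - 3) (hq1 : 1 ≤ q) (hq2 : q ≤ (n : ℤ) - 3) :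
    sFjord n p q ≤ (polyA n : ℚ) := by
  obtain ⟨Q, rfl⟩ : ∃ Q : ℕ, p = Q := ⟨p.toNat, by omega⟩
  obtain ⟨P, rfl⟩ : ∃ P : ℕ, q = P := ⟨q.toNat, by omega⟩
  have hP : 1 ≤ P := by omega
  have hPn : P + 3 ≤ n := by omega
  have hQ : 1 ≤ Q := by omega
  have hQn : Q + 3 ≤ n := by omega
  have hS := weight_snake hP hPn hQ hQn
  have hR := weight_side (w := (0, 1)) (u := (-1, 0)) (b := ((n : ℤ), 1)) (s := n - Q - 2) (t := Q)
    (by norm_num) (by norm_num) (by norm_num)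
  have hB := weight_side (w := (-1, 0)) (u := (0, 1)) (b := ((n : ℤ), 1)) (s := n - P - 2) (t := P)
    (by norm_num) (by norm_num) (by norm_num)
  have hG := two_mul_gainSum (n - 1)
  have hle := weight_add_le_polyA hP hPn hQ hQn
  have hsQ : ((n - Q - 2 : ℕ) : ℤ) = n - Q - 2 := by omega
  have hsP : ((n - P - 2 : ℕ) : ℤ) = n - P - 2 := by omega
  rw [show n - 1 + 1 = n by omega, Nat.cast_sub (by omega : 1 ≤ n)] at hG
  rw [hsQ] at hR
  rw [hsP] at hB
  qify at hS hR hB hle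
  refine le_trans (le_of_eq ?_) hle
  rw [hS, hR, hB]
  unfold sFjord
  push_cast at hG ⊢
  linear_combination -hG
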